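/- arXiv:2104.10080 — 4 statements merged into one kernel-verified Lean document; each statement's English description precedes it below -/
import Mathlib

section
/- Let n ≥ 3 be an odd integer and let k ≥ 3 be an integer. Then k divides n if and only if the independence polynomial I(C_k,x) divides the independence polynomial I(C_n,x) in ℚ[x]. -/
open Polynomial SimpleGraph

/-- A finset of vertices is independent if no two of its vertices are adjacent. -/
def SimpleGraph.IsIndepFinset {V : Type*} (G : SimpleGraph V) (s : Finset V) : Prop :=
  ∀ v ∈ s, ∀ w ∈ s, ¬ G.Adj v w

open scoped Classical in
/-- The independence polynomial `I(G,x) = Σ_k i_k(G) xᵏ` of a finite simple graph,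
regarded as a polynomial with rational coefficients. -/
noncomputable def SimpleGraph.indepPoly {V : Type*} [Fintype V] (G : SimpleGraph V) :
    Polynomial ℚ :=
  ∑ s : Finset V, if G.IsIndepFinset s then (X : Polynomial ℚ) ^ s.card else 0

/-- Lucas-type polynomials. -/
noncomputable def lucP : ℕ → Polynomial ℚ
  | 0 => 2
  | 1 => 1
  | (n + 2) => lucP (n + 1) + X * lucP n

/-- Transfer weights. -/
noncomputable def trW (a b : Bool) : Polynomial ℚ :=
  if a then (if b then 0 else X) else 1

/-- Weighted walks. -/
noncomputable def walkW : ℕ → Bool → Bool → Polynomial ℚ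
  | 0, a, b => if a = b then 1 else 0
  | (n + 1), a, b => ∑ c, trW a c * walkW n c b

lemma walkW_rec (n : ℕ) (a b : Bool) :
    walkW (n + 2) a b = walkW (n + 1) a b + X * walkW n a b := by
  cases a <;> simp [walkW, trW] <;> ring

lemma trace_eq (n : ℕ) : walkW n false false + walkW n true true = lucP n ∧
    walkW (n+1) false false + walkW (n+1) true true = lucP (n+1) := by
  induction n with
  | zero => constructor <;> simp [walkW, lucP, trW] <;> norm_num
  | succ n ih =>
    refine ⟨ih.2, ?_⟩
    rw [walkW_rec, walkW_rec, lucP, ← ih.1, ← ih.2]; ring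

lemma walkW_sum (n : ℕ) (a b : Bool) :
    walkW (n + 1) a b = ∑ f : Fin n → Bool,
      ∏ i : Fin (n + 1), trW ((Fin.cons a f : Fin (n+1) → Bool) i)
        ((Fin.snoc f b : Fin (n+1) → Bool) i) := by
  induction n generalizing a with
  | zero => cases a <;> cases b <;> simp [walkW, Fin.snoc]
  | succ n ih =>
    rw [walkW, ← (Fin.consEquiv (fun _ => Bool)).sum_comp, Fintype.sum_prod_type]
    refine Finset.sum_congr rfl fun c _ => ?_
    rw [ih, Finset.mul_sum]
    refine Finset.sum_congr rfl fun f _ => ?_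
    rw [Fin.prod_univ_succ (n := n + 1)]
    simp only [Fin.consEquiv, Equiv.coe_fn_mk, ← Fin.cons_snoc_eq_snoc_cons, Fin.cons_zero,
      Fin.cons_succ]

lemma trace_sum (n : ℕ) :
    lucP (n + 1) = ∑ f : Fin (n + 1) → Bool, ∏ i, trW (f i) (f (i + 1)) := by
  rw [← (trace_eq n).2, ← (Fin.consEquiv (fun _ => Bool)).sum_comp, Fintype.sum_prod_type]
  rw [Fintype.sum_bool, walkW_sum, walkW_sum, add_comm]
  have key : ∀ (a : Bool) (f : Fin n → Bool) (i : Fin (n+1)),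
      (Fin.snoc f a : Fin (n+1) → Bool) i = (Fin.cons a f : Fin (n+1) → Bool) (i + 1) := by
    intro a f i
    induction i using Fin.lastCases with
    | last => simp
    | cast i => simp
  simp [key, Fin.consEquiv]

lemma indep_iff (n : ℕ) (s : Finset (Fin (n + 2))) :
    (cycleGraph (n + 2)).IsIndepFinset s ↔ ∀ i, i ∈ s → i + 1 ∉ s := by
  unfold SimpleGraph.IsIndepFinset
  constructor
  · intro h i hi hi'
    exact h i hi _ hi' (by rw [cycleGraph_adj]; right; simp)
  · intro h v hv w hw hvw
    rw [cycleGraph_adj] at hvw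
    rcases hvw with e | e
    · rw [sub_eq_iff_eq_add] at e
      exact h w hw (by rwa [add_comm w 1, ← e])
    · rw [sub_eq_iff_eq_add] at e
      exact h v hv (by rwa [add_comm v 1, ← e])

lemma indepPoly_cycle (n : ℕ) : (cycleGraph (n + 2)).indepPoly = lucP (n + 2) := by
  classical
  rw [trace_sum, SimpleGraph.indepPoly]
  refine Fintype.sum_bijective (fun s i => decide (i ∈ s)) ?_ _ _ ?_
  · constructor
    · intro s t h
      ext i
      simpa using congrFun h i
    · intro f
      exact ⟨Finset.univ.filter (fun i => f i = true), by ext i; simp⟩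
  · intro s
    split_ifs with h
    · rw [indep_iff] at h
      rw [Finset.prod_congr rfl (g := fun i => if i ∈ s then (X : ℚ[X]) else 1)]
      · simp [Finset.prod_ite_mem]
      · intro i _
        by_cases hi : i ∈ s
        · simp [trW, hi, h i hi]
        · simp [trW, hi]
    · rw [indep_iff] at h
      push Not at h
      obtain ⟨i, hi, hi'⟩ := h
      symm
      apply Finset.prod_eq_zero (Finset.mem_univ i)
      simp [trW, hi, hi']

lemma lucP_mul (k m : ℕ) :
    lucP (m + k) * lucP k = lucP (m + 2 * k) + (-X) ^ k * lucP m ∧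
    lucP (m + (k+1)) * lucP (k+1) = lucP (m + 2 * (k+1)) + (-X) ^ (k+1) * lucP m := by
  induction k generalizing m with
  | zero =>
    constructor
    · simp [lucP]; ring
    · have : lucP (m + 2) = lucP (m+1) + X * lucP m := by rw [lucP]
      simp [this, lucP]
  | succ k ih =>
    refine ⟨(ih m).2, ?_⟩
    have h1 := (ih (m+1)).2
    have h2 := (ih (m+2)).1
    have e0 : lucP (m + 2) = lucP (m+1) + X * lucP m := by rw [lucP]
    have e1 : lucP (k + 1 + 1) = lucP (k+1) + X * lucP k := by rw [lucP]
    have e2 : lucP (m + 2 * (k + 1 + 1)) = lucP (m + 1 + 2 * (k+1)) + X * lucP (m + 2 + 2 * k) := by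
      rw [show m + 2 * (k + 1 + 1) = (m + 2 + 2 * k) + 2 by ring, lucP]
      congr 2; ring
    rw [show m + 1 + (k + 1) = m + (k + 1 + 1) by ring] at h1
    rw [show m + 2 + k = m + (k + 1 + 1) by ring] at h2
    rw [e1, e2, mul_add, h1, mul_left_comm, h2, e0]
    ring

lemma lucP_coeff_zero (n : ℕ) : (lucP (n+1)).coeff 0 = 1 := by
  induction n with
  | zero => simp [lucP]
  | succ n ih => rw [lucP]; simp [ih]

lemma lucP_deg (m : ℕ) : (lucP (2*m)).natDegree ≤ m ∧ (lucP (2*m+1)).natDegree ≤ m ∧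
    (lucP (2*m)).coeff m = 2 ∧ (lucP (2*m+1)).coeff m = 2 * m + 1 := by
  induction m with
  | zero =>
    have h : (2 : ℚ[X]) = C 2 := rfl
    simp [lucP, h]
  | succ m ih =>
    obtain ⟨h1, h2, h3, h4⟩ := ih
    have e1 : lucP (2 * (m+1)) = lucP (2*m+1) + X * lucP (2*m) := by
      rw [show 2 * (m+1) = 2*m+2 by ring, lucP]
    have e2 : lucP (2 * (m+1) + 1) = lucP (2*(m+1)) + X * lucP (2*m+1) := by
      rw [show 2 * (m+1) + 1 = 2*m+1+2 by ring, lucP]; rfl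
    have d : ∀ p : ℚ[X], p.natDegree ≤ m → (X * p).natDegree ≤ m + 1 := by
      intro p hp
      refine natDegree_mul_le.trans ?_
      rw [natDegree_X]; omega
    have a1 : (lucP (2 * (m+1))).natDegree ≤ m + 1 := by
      rw [e1]; exact natDegree_add_le_of_degree_le (by omega) (d _ h1)
    have c1 : (lucP (2 * (m+1))).coeff (m+1) = 2 := by
      rw [e1, coeff_add, coeff_X_mul, h3, coeff_eq_zero_of_natDegree_lt (by omega), zero_add]
    refine ⟨a1, ?_, c1, ?_⟩
    · rw [e2]; exact natDegree_add_le_of_degree_le a1 (d _ h2)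
    · rw [e2, coeff_add, coeff_X_mul, h4, c1]; push_cast; ring

lemma lucP_natDegree (n : ℕ) : (lucP n).natDegree = n / 2 := by
  obtain ⟨h1, h2, h3, h4⟩ := lucP_deg (n / 2)
  rcases Nat.mod_two_eq_zero_or_one n with h | h
  · have e : 2 * (n / 2) = n := by omega
    rw [e] at h1 h3
    exact le_antisymm h1 (le_natDegree_of_ne_zero (by rw [h3]; norm_num))
  · have e : 2 * (n / 2) + 1 = n := by omega
    rw [e] at h2 h4
    exact le_antisymm h2 (le_natDegree_of_ne_zero (by rw [h4]; positivity))

lemma lucP_coprime (k j : ℕ) (hk : 0 < k) : IsCoprime (lucP k) ((-X) ^ j) := by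
  apply IsCoprime.pow_right
  apply IsCoprime.neg_right
  apply IsCoprime.symm
  rw [Polynomial.irreducible_X.coprime_iff_not_dvd, X_dvd_iff]
  obtain ⟨m, rfl⟩ := Nat.exists_eq_succ_of_ne_zero hk.ne'
  rw [lucP_coeff_zero]; norm_num

lemma dvd_of_lucP (k : ℕ) (hk : 0 < k) (n : ℕ) (hn : Odd n) (h : lucP k ∣ lucP n) : k ∣ n := by
  induction n using Nat.strong_induction_on with
  | _ n ih =>
  have small : ∀ r, Odd r → r < k → ¬ lucP k ∣ lucP r := by
    intro r hr hrk hd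
    have hne : lucP r ≠ 0 := by
      intro h0
      obtain ⟨m, rfl⟩ := hr
      have := lucP_coeff_zero (2*m)
      simp [h0] at this
    have := natDegree_le_of_dvd hd hne
    rw [lucP_natDegree, lucP_natDegree] at this
    obtain ⟨m, rfl⟩ := hr
    omega
  rcases lt_trichotomy n k with h1 | h1 | h1
  · exact absurd h (small n hn h1)
  · rw [h1]
  · rcases lt_or_ge n (2 * k) with h2 | h2
    · exfalso
      have e := (lucP_mul (n - k) (2 * k - n)).1
      rw [show 2 * k - n + (n - k) = k by omega,
        show 2 * k - n + 2 * (n - k) = n by omega] at e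
      refine small (2 * k - n) ?_ (by omega) ?_
      · obtain ⟨m, rfl⟩ := hn
        exact ⟨k - m - 1, by omega⟩
      · exact (lucP_coprime k (n-k) hk).dvd_of_dvd_mul_left
          ((dvd_add_right h).1 (e ▸ dvd_mul_right _ _))
    · have e := (lucP_mul k (n - 2 * k)).1
      rw [show n - 2 * k + 2 * k = n by omega] at e
      have := ih (n - 2 * k) (by omega) (by
        obtain ⟨m, rfl⟩ := hn
        exact ⟨m - k, by omega⟩)
        ((lucP_coprime k k hk).dvd_of_dvd_mul_left
          ((dvd_add_right h).1 (e ▸ dvd_mul_left _ _)))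
      have h3 := dvd_add this (Dvd.intro_left 2 rfl : k ∣ 2 * k)
      rwa [show n - 2 * k + 2 * k = n by omega] at h3

lemma lucP_dvd (k m : ℕ) : lucP k ∣ lucP (k * (2 * m + 1)) := by
  induction m with
  | zero => simp
  | succ m ih =>
    have e := (lucP_mul k (k * (2 * m + 1))).1
    rw [show k * (2 * (m + 1) + 1) = k * (2 * m + 1) + 2 * k by ring]
    exact (dvd_add_left (ih.mul_left _)).1 (e ▸ dvd_mul_left _ _)

/-- For odd `n ≥ 3` and `k ≥ 3`, `k` divides `n` iff `I(C_k,x)` divides `I(C_n,x)` in `ℚ[x]`. -/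
theorem dvd_iff_indepPoly_cycle_dvd (n k : ℕ) (hn : 3 ≤ n) (hodd : Odd n) (hk : 3 ≤ k) :
    k ∣ n ↔ (cycleGraph k).indepPoly ∣ (cycleGraph n).indepPoly := by
  have e1 : (cycleGraph k).indepPoly = lucP k := by
    obtain ⟨j, rfl⟩ := Nat.exists_eq_add_of_le' (show 2 ≤ k by omega)
    exact indepPoly_cycle j
  have e2 : (cycleGraph n).indepPoly = lucP n := by
    obtain ⟨j, rfl⟩ := Nat.exists_eq_add_of_le' (show 2 ≤ n by omega)
    exact indepPoly_cycle j
  rw [e1, e2]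
  constructor
  · rintro ⟨c, rfl⟩
    obtain ⟨m, rfl⟩ := (Nat.odd_mul.1 hodd).2
    exact lucP_dvd k m
  · exact dvd_of_lucP k (by omega) n hodd
end

section
/- Let n ≥ 3 be odd and let G be a finite simple graph with I(G,x) = I(C_n,x). Then every connected component of G is unicyclic, i.e. every connected component contains exactly one cycle (equivalently, has as many edges as vertices). -/
open Polynomial SimpleGraph

lemma esymm_two_rel {R : Type*} [CommRing R] (s : Multiset R) :
    s.sum ^ 2 = (s.map fun r => r ^ 2).sum + 2 * s.esymm 2 := by
  induction s using Multiset.induction_on with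
  | empty => simp [Multiset.esymm, Multiset.powersetCard_zero_right]
  | cons a s ih =>
    have h2 : (a ::ₘ s).esymm 2 = s.esymm 2 + a * s.sum := by
      simp [Multiset.esymm, Multiset.powersetCard_cons, Multiset.powersetCard_one,
        Multiset.map_map]
      simpa using Multiset.sum_map_mul_left (s := s) (f := fun x => x) (a := a)
    rw [h2, Multiset.sum_cons, Multiset.map_cons, Multiset.sum_cons]
    linear_combination ih

lemma exists_sq_aut {n : ℕ} (hn : 3 ≤ n) (hodd : Odd n) :
    ∃ σ : AlgebraicClosure ℚ ≃ₐ[ℚ] AlgebraicClosure ℚ,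
      ∀ z : AlgebraicClosure ℚ, z ^ n = 1 → σ z = z ^ 2 := by
  have : NeZero n := ⟨by omega⟩
  have : NeZero (n : AlgebraicClosure ℚ) := ⟨by exact_mod_cast (by omega : n ≠ 0)⟩
  obtain ⟨ζ, hζ⟩ := HasEnoughRootsOfUnity.exists_primitiveRoot (AlgebraicClosure ℚ) n
  have hζ2 : IsPrimitiveRoot (ζ ^ 2) n :=
    hζ.pow_of_coprime 2 (Nat.coprime_two_left.mpr hodd)
  have h1 := cyclotomic_eq_minpoly_rat hζ (by omega)
  have h2 := cyclotomic_eq_minpoly_rat hζ2 (by omega)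
  have hA : Algebra.IsAlgebraic ℚ (AlgebraicClosure ℚ) := by
    have hs : (DivisionRing.toRatAlgebra : Algebra ℚ (AlgebraicClosure ℚ)) =
        AlgebraicClosure.instAlgebra ℚ := Subsingleton.elim _ _
    rw [hs]
    exact AlgebraicClosure.isAlgebraic ℚ
  have hN : Normal ℚ (AlgebraicClosure ℚ) := normal_iff.2 fun x =>
    ⟨(Algebra.IsAlgebraic.isAlgebraic x).isIntegral, IsAlgClosed.splits _⟩
  obtain ⟨σ, hσ⟩ := minpoly.exists_algEquiv_of_root' (K := ℚ) (x := ζ ^ 2) (y := ζ)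
    (Algebra.IsAlgebraic.isAlgebraic _) (by rw [← h1, h2]; exact minpoly.aeval _ _)
  refine ⟨σ, fun z hz => ?_⟩
  obtain ⟨i, -, rfl⟩ := hζ.eq_pow_of_pow_eq_one hz
  rw [map_pow, hσ]; ring

/-- The key algebraic fact. -/
lemma key_alg {n : ℕ} (hn : 3 ≤ n) (hodd : Odd n) (p : ℚ[X]) (N : ℕ)
    (hdeg : p.natDegree ≤ N) (h0 : p.coeff 0 = 1)
    (hroot : ∀ x : AlgebraicClosure ℚ, aeval x p = 0 →
      ∃ z : AlgebraicClosure ℚ, z ^ n = 1 ∧ x⁻¹ = z + z⁻¹ - 2) :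
    p.coeff 1 ^ 2 - 2 * p.coeff 2 = 3 * p.coeff 1 := by
  obtain ⟨σ, hσ⟩ := exists_sq_aut hn hodd
  set K := AlgebraicClosure ℚ
  set Q : ℚ[X] := reflect (N + 2) p with hQ
  have hQc : ∀ k, k ≤ N + 2 → Q.coeff (N + 2 - k) = p.coeff k := by
    intro k hk
    rw [hQ, coeff_reflect, revAt_le (by omega)]
    congr 1; omega
  have hQd : Q.natDegree = N + 2 := by
    refine natDegree_eq_of_le_of_coeff_ne_zero ?_ ?_
    · rw [natDegree_le_iff_coeff_eq_zero]
      intro m hm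
      rw [hQ, coeff_reflect, revAt_eq_self_of_lt hm]
      exact coeff_eq_zero_of_natDegree_lt (by omega)
    · have := hQc 0 (by omega)
      rw [Nat.sub_zero] at this
      rw [this, h0]; simp
  have hQm : Q.Monic := by
    have := hQc 0 (by omega)
    rw [Nat.sub_zero, h0] at this
    rw [Monic, leadingCoeff, hQd, this]
  set P : K[X] := Q.map (algebraMap ℚ K) with hP
  have hPm : P.Monic := hQm.map _
  have hPd : P.natDegree = N + 2 := by rw [hP, natDegree_map, hQd]
  have hsp : P.Splits := IsAlgClosed.splits P
  have hcard : P.roots.card = P.natDegree := hsp.natDegree_eq_card_roots.symm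
  set R := P.roots with hR
  -- automorphism permutes
  have hperm : R.map σ = R := by
    have := hsp.roots_map (σ : K →+* K)
    have h2 : P.map (σ : K →+* K) = P := by
      rw [hP, Polynomial.map_map]
      congr 1
      ext x
      exact σ.commutes x
    rw [h2] at this
    exact this.symm
  have hval : ∀ y ∈ R, σ y = y ^ 2 + 4 * y := by
    intro y hy
    have hy0 : eval₂ (algebraMap ℚ K) y Q = 0 := by
      have := isRoot_of_mem_roots hy
      rwa [hP, IsRoot, eval_map] at this
    by_cases hz : y = 0
    · simp [hz]
    · have hyi : y⁻¹ ≠ 0 := inv_ne_zero hz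
      let _ : Invertible y⁻¹ := invertibleOfNonzero hyi
      have h3 := (eval₂_reflect_eq_zero_iff (algebraMap ℚ K) y⁻¹ (N + 2) p (by omega))
      rw [invOf_eq_inv, inv_inv] at h3
      obtain ⟨z, hz1, hz2⟩ := hroot y⁻¹ (h3.1 hy0)
      rw [inv_inv] at hz2
      have hz0 : z ≠ 0 := by
        rintro rfl
        rw [zero_pow (by omega)] at hz1
        exact zero_ne_one hz1
      rw [hz2]
      simp only [map_sub, map_add, map_inv₀, hσ z hz1, map_ofNat]
      field_simp
      ring
  have hsum : R.sum = (R.map fun y => y ^ 2).sum + 4 * R.sum := by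
    conv_lhs => rw [← hperm, Multiset.map_congr rfl hval, Multiset.sum_map_add,
      Multiset.sum_map_mul_left, Multiset.map_id']
  have he := esymm_two_rel R
  have hc1 := coeff_eq_esymm_roots_of_card hcard (k := N + 1) (by omega)
  have hc2 := coeff_eq_esymm_roots_of_card hcard (k := N) (by omega)
  rw [hPm.leadingCoeff, hPd] at hc1 hc2
  rw [show N + 2 - (N + 1) = 1 by omega, hP, coeff_map,
    show N + 1 = N + 2 - 1 by omega, hQc 1 (by omega)] at hc1
  rw [show N + 2 - N = 2 by omega, hP, coeff_map] at hc2
  have := hQc 2 (by omega)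
  rw [show N + 2 - 2 = N by omega] at this
  rw [this] at hc2
  have e1 : R.esymm 1 = R.sum := by
    simp [Multiset.esymm, Multiset.powersetCard_one, Multiset.map_map]
  rw [← hP, ← hR] at hc1 hc2
  rw [e1] at hc1
  apply (algebraMap ℚ K).injective
  simp only [map_sub, map_mul, map_pow, map_ofNat]
  rw [hc1, hc2]
  linear_combination he - hsum

lemma root_form {K : Type*} [Field K] [IsAlgClosed K] {n : ℕ} (hodd : Odd n) (x : K) (hx : x ≠ 0)
    (h : ∀ a b : K, a + b = 1 → a * b = -x → a ^ n + b ^ n = 0) :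
    ∃ z : K, z ^ n = 1 ∧ x⁻¹ = z + z⁻¹ - 2 := by
  obtain ⟨a, ha⟩ := IsAlgClosed.exists_root (X ^ 2 - X - C x : K[X]) (by
    rw [show (X ^ 2 - X - C x : K[X]) = C 1 * X ^ 2 + C (-1) * X + C (-x) by simp; ring]
    rw [degree_quadratic one_ne_zero]; simp)
  have ha : a ^ 2 - a - x = 0 := by simpa using ha
  set b := 1 - a with hb
  have hab : a * b = -x := by rw [hb]; linear_combination -ha
  have hn := h a b (by rw [hb]; ring) hab
  have hb0 : b ≠ 0 := by
    intro h0; rw [h0, mul_zero] at hab; exact hx (by linear_combination hab)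
  have ha0 : a ≠ 0 := by
    intro h0; rw [h0, zero_mul] at hab; exact hx (by linear_combination hab)
  refine ⟨-a / b, ?_, ?_⟩
  · rw [div_pow, hodd.neg_pow, div_eq_one_iff_eq (pow_ne_zero _ hb0)]
    linear_combination -hn
  · have : x = - (a * b) := by linear_combination hab
    rw [this]
    have h1 : a + b = 1 := by rw [hb]; ring
    field_simp
    linear_combination (- (a + b) - 1) * h1

lemma path_sum {K : Type*} [CommRing K] (M : Matrix Bool Bool K) (m : ℕ) (g : Bool → Bool → K) :
    ∑ f : Fin (m + 1) → Bool, (∏ i : Fin m, M (f i.castSucc) (f i.succ)) * g (f 0) (f (Fin.last m))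
      = ∑ u, ∑ v, (M ^ m) u v * g u v := by
  induction m generalizing g with
  | zero =>
    rw [← (Equiv.funUnique (Fin 1) Bool).symm.sum_comp]
    simp [Matrix.one_apply]
  | succ m ih =>
    rw [← (Fin.consEquiv (fun _ => Bool)).sum_comp, Fintype.sum_prod_type]
    have : ∀ u : Bool, ∑ f : Fin (m + 1) → Bool,
        (∏ i : Fin (m + 1), M ((Fin.consEquiv (fun _ => Bool)) (u, f) i.castSucc)
          ((Fin.consEquiv (fun _ => Bool)) (u, f) i.succ)) *
          g ((Fin.consEquiv (fun _ => Bool)) (u, f) 0)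
            ((Fin.consEquiv (fun _ => Bool)) (u, f) (Fin.last (m + 1))) =
        ∑ w, ∑ v, (M ^ m) w v * (M u w * g u v) := by
      intro u
      rw [← ih (fun w v => M u w * g u v)]
      refine Finset.sum_congr rfl fun f _ => ?_
      rw [Fin.prod_univ_succ]
      simp only [Fin.consEquiv, Equiv.coe_fn_mk, Fin.castSucc_zero, Fin.cons_zero, Fin.cons_succ,
        ← Fin.succ_castSucc, ← Fin.succ_last]
      ring
    rw [Finset.sum_congr rfl fun u _ => this u]
    refine Finset.sum_congr rfl fun u _ => ?_
    rw [Finset.sum_comm]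
    refine Finset.sum_congr rfl fun v _ => ?_
    rw [pow_succ', Matrix.mul_apply, Finset.sum_mul]
    refine Finset.sum_congr rfl fun w _ => ?_
    ring

lemma cycle_sum {K : Type*} [CommRing K] (M : Matrix Bool Bool K) (m : ℕ) :
    ∑ f : Fin (m + 1) → Bool, (∏ i, M (f i) (f (i + 1))) = (M ^ (m + 1)).trace := by
  have := path_sum M m (fun u v => M v u)
  rw [pow_succ, Matrix.trace]
  simp only [Matrix.diag_apply, Matrix.mul_apply]
  rw [← this]
  refine Finset.sum_congr rfl fun f _ => ?_
  rw [Fin.prod_univ_castSucc]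
  simp

lemma trace_form {K : Type*} [CommRing K] (x a b : K) (h1 : a + b = 1) (h2 : a * b = -x)
    (M : Matrix Bool Bool K)
    (hM : M = Matrix.of fun u v => (if u then x else 1) * (if u && v then 0 else 1)) (n : ℕ) :
    (M ^ n).trace = a ^ n + b ^ n := by
  have hM2 : M ^ 2 = M + x • 1 := by
    rw [hM, pow_two]
    ext u v
    cases u <;> cases v <;> simp [Matrix.mul_apply, add_comm]
  induction n using Nat.strong_induction_on with
  | _ n ih =>
    match n with
    | 0 => simp [Matrix.trace]; norm_num
    | 1 => rw [hM]; simp [Matrix.trace, h1]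
    | k + 2 =>
      have e : M ^ (k + 2) = M ^ (k + 1) + x • M ^ k := by
        rw [pow_add, hM2, mul_add, ← pow_succ]; simp
      rw [e, Matrix.trace_add, Matrix.trace_smul, ih _ (by omega), ih _ (by omega), smul_eq_mul]
      have hx : x = - (a * b) := by rw [h2]; ring
      have hb : b = 1 - a := by rw [← h1]; ring
      rw [hx, hb]; ring

open scoped Classical in
lemma cycle_eval {K : Type*} [Field K] [Algebra ℚ K] (m : ℕ) (x a b : K) (h1 : a + b = 1)
    (h2 : a * b = -x) :
    aeval x (cycleGraph (m + 2)).indepPoly = a ^ (m + 2) + b ^ (m + 2) := by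
  rw [← trace_form x a b h1 h2 _ rfl, ← cycle_sum, SimpleGraph.indepPoly, map_sum]
  let e : Finset (Fin (m + 2)) ≃ (Fin (m + 2) → Bool) :=
    { toFun := fun s i => decide (i ∈ s)
      invFun := fun f => Finset.univ.filter fun i => f i = true
      left_inv := fun s => by ext; simp
      right_inv := fun f => by ext; simp }
  refine Fintype.sum_equiv e _ _ fun s => ?_
  have he : ∀ i, e s i = decide (i ∈ s) := fun i => rfl
  simp only [Matrix.of_apply, he, decide_eq_true_eq, Bool.and_eq_true]
  rw [Finset.prod_mul_distrib, Finset.prod_ite]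
  have hind : (cycleGraph (m + 2)).IsIndepFinset s ↔ ∀ i, ¬ (i ∈ s ∧ i + 1 ∈ s) := by
    constructor
    · rintro h i ⟨hi, hj⟩
      refine h i hi _ hj ?_
      rw [cycleGraph_adj]; right; simp
    · intro h v hv w hw hadj
      rw [cycleGraph_adj] at hadj
      rcases hadj with hh | hh
      · exact h w ⟨hw, by rw [← hh]; simpa using hv⟩
      · exact h v ⟨hv, by rw [← hh]; simpa using hw⟩
  by_cases hs : (cycleGraph (m + 2)).IsIndepFinset s
  · rw [if_pos hs]
    have := hind.1 hs
    rw [Finset.prod_eq_one (f := fun i => if i ∈ s ∧ i + 1 ∈ s then (0 : K) else 1)]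
    · simp
    · intro i _; rw [if_neg (this i)]
  · rw [if_neg hs]
    rw [hind] at hs
    push Not at hs
    obtain ⟨i, hi⟩ := hs
    rw [Finset.prod_eq_zero (Finset.mem_univ i) (f := fun i => if i ∈ s ∧ i + 1 ∈ s then (0 : K) else 1)]
    · simp
    · rw [if_pos hi]

open scoped Classical in
noncomputable def IA {V : Type*} (G : SimpleGraph V) (A : Finset V) : ℚ[X] :=
  ∑ s ∈ A.powerset, if G.IsIndepFinset s then (X : ℚ[X]) ^ s.card else 0

open scoped Classical in
lemma IA_mul {V : Type*} (G : SimpleGraph V) (A B : Finset V) (hd : Disjoint A B)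
    (h : ∀ v ∈ A, ∀ w ∈ B, ¬ G.Adj v w) : IA G (A ∪ B) = IA G A * IA G B := by
  unfold IA
  rw [Finset.sum_mul_sum, ← Finset.sum_product']
  symm
  refine Finset.sum_bij' (fun p _ => p.1 ∪ p.2) (fun s _ => (s ∩ A, s ∩ B)) ?_ ?_ ?_ ?_ ?_
  · rintro ⟨s, t⟩ hp
    simp only [Finset.mem_product, Finset.mem_powerset] at hp ⊢
    exact Finset.union_subset_union hp.1 hp.2
  · intro s _
    simp
  · rintro ⟨s, t⟩ hp
    simp only [Finset.mem_product, Finset.mem_powerset] at hp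
    have := Finset.disjoint_left.1 hd
    ext i
    · simp only [Finset.mem_inter, Finset.mem_union]
      constructor
      · rintro ⟨h1 | h1, h2⟩
        · exact h1
        · exact absurd (hp.2 h1) (this h2)
      · intro h1; exact ⟨Or.inl h1, hp.1 h1⟩
    · simp only [Finset.mem_inter, Finset.mem_union]
      constructor
      · rintro ⟨h1 | h1, h2⟩
        · exact absurd h2 (this (hp.1 h1))
        · exact h1
      · intro h1; exact ⟨Or.inr h1, hp.2 h1⟩
  · intro s hs
    simp only [Finset.mem_powerset] at hs
    rw [← Finset.inter_union_distrib_left, Finset.inter_eq_left.2 hs]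
  · rintro ⟨s, t⟩ hp
    simp only [Finset.mem_product, Finset.mem_powerset] at hp
    have hiff : G.IsIndepFinset (s ∪ t) ↔ G.IsIndepFinset s ∧ G.IsIndepFinset t := by
      constructor
      · intro hh
        exact ⟨fun v hv w hw => hh v (Finset.mem_union_left _ hv) w (Finset.mem_union_left _ hw),
          fun v hv w hw => hh v (Finset.mem_union_right _ hv) w (Finset.mem_union_right _ hw)⟩
      · rintro ⟨h1, h2⟩ v hv w hw
        rcases Finset.mem_union.1 hv with hv | hv <;> rcases Finset.mem_union.1 hw with hw | hw
        · exact h1 v hv w hw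
        · exact h v (hp.1 hv) w (hp.2 hw)
        · exact fun hh => h w (hp.1 hw) v (hp.2 hv) hh.symm
        · exact h2 v hv w hw
    have hc : (s ∪ t).card = s.card + t.card :=
      Finset.card_union_of_disjoint (hd.mono hp.1 hp.2)
    simp only [hiff, hc, pow_add]
    by_cases h1 : G.IsIndepFinset s <;> by_cases h2 : G.IsIndepFinset t <;> simp [h1, h2]

open scoped Classical in
lemma IA_coeff {V : Type*} (G : SimpleGraph V) (A : Finset V) (k : ℕ) :
    (IA G A).coeff k = (((A.powersetCard k).filter fun s => G.IsIndepFinset s).card : ℚ) := by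
  unfold IA
  rw [finsetSum_coeff, Finset.card_filter, Nat.cast_sum, Finset.powersetCard_eq_filter,
    Finset.sum_filter]
  refine Finset.sum_congr rfl fun s _ => ?_
  by_cases h1 : G.IsIndepFinset s <;> by_cases h2 : s.card = k <;>
    simp [h1, h2, coeff_X_pow, eq_comm]
  intro h; exact absurd h.symm h2

open scoped Classical in
lemma IA_coeff_two {V : Type*} [Fintype V] (G : SimpleGraph V) (A : Finset V) :
    (IA G A).coeff 2 + ((G.edgeFinset.filter fun e => ∀ v ∈ e, v ∈ A).card : ℚ)
      = A.card.choose 2 := by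
  rw [IA_coeff, ← Finset.card_powersetCard, ← Finset.card_filter_add_card_filter_not
    (s := A.powersetCard 2) (fun s => G.IsIndepFinset s)]
  push_cast
  congr 2
  refine Finset.card_bij (fun e _ => e.toFinset) ?_ ?_ ?_
  · intro e he
    induction e with | _ v w =>
    simp only [Finset.mem_filter, mem_edgeFinset, mem_edgeSet] at he
    simp only [Finset.mem_filter, Finset.mem_powersetCard]
    refine ⟨⟨fun i hi => he.2 i (by simpa using hi), ?_⟩, ?_⟩
    · exact Sym2.card_toFinset_of_not_isDiag _ (by simpa using he.1.ne)
    · intro hi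
      exact hi v (by simp) w (by simp) he.1
  · intro e _ e' _ hee
    apply Sym2.ext
    intro i
    rw [← Sym2.mem_toFinset, ← Sym2.mem_toFinset, hee]
  · intro s hs
    simp only [Finset.mem_filter, Finset.mem_powersetCard] at hs
    obtain ⟨⟨hsA, hc⟩, hi⟩ := hs
    obtain ⟨v, w, hvw, rfl⟩ := Finset.card_eq_two.1 hc
    have hadj : G.Adj v w := by
      by_contra hna
      apply hi
      intro a ha b hb hab
      simp only [Finset.mem_insert, Finset.mem_singleton] at ha hb
      rcases ha with rfl | rfl <;> rcases hb with rfl | rfl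
      · exact hab.ne rfl
      · exact hna hab
      · exact hna hab.symm
      · exact hab.ne rfl
    refine ⟨s(v, w), ?_, ?_⟩
    · simp only [Finset.mem_filter, mem_edgeFinset, mem_edgeSet]
      exact ⟨hadj, fun i hi => hsA (by simpa using hi)⟩
    · ext; simp

open scoped Classical in
/-- For odd `n ≥ 3`, if `I(G,x) = I(C_n,x)` then every connected component of `G` is
unicyclic: the number of edges of `G` lying inside the component equals the number
of vertices of the component. -/
theorem components_unicyclic {n : ℕ} (hn : 3 ≤ n) (hodd : Odd n)
    {V : Type} [Fintype V] (G : SimpleGraph V)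
    (h : G.indepPoly = (cycleGraph n).indepPoly) :
    ∀ c : G.ConnectedComponent,
      (G.edgeFinset.filter fun e => ∀ v ∈ e, v ∈ c.supp).card = c.supp.ncard := by
  intro c
  set A : Finset V := c.supp.toFinset with hA
  have hmem : ∀ v, v ∈ c.supp ↔ v ∈ A := fun v => by simp [hA]
  have hcard : c.supp.ncard = A.card := Set.ncard_eq_toFinset_card' _
  simp only [hmem, hcard]
  have hfac : IA G A ∣ (cycleGraph n).indepPoly := by
    refine ⟨IA G Aᶜ, ?_⟩
    rw [← h, ← IA_mul G A Aᶜ disjoint_compl_right]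
    · unfold IA SimpleGraph.indepPoly
      simp
    · intro v hv w hw hadj
      rw [Finset.mem_compl, ← hmem] at hw
      rw [← hmem] at hv
      apply hw
      rw [ConnectedComponent.mem_supp_iff] at hv ⊢
      rw [← hv]
      exact ConnectedComponent.connectedComponentMk_eq_of_adj hadj.symm
  have h0 : (IA G A).coeff 0 = 1 := by
    rw [IA_coeff]
    simp [Finset.filter_singleton, SimpleGraph.IsIndepFinset]
  have h1 : (IA G A).coeff 1 = A.card := by
    rw [IA_coeff, Finset.filter_true_of_mem, Finset.card_powersetCard, Nat.choose_one_right]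
    intro s hs
    rw [Finset.mem_powersetCard] at hs
    obtain ⟨v, rfl⟩ := Finset.card_eq_one.1 hs.2
    intro a ha b hb
    simp only [Finset.mem_singleton] at ha hb
    rw [ha, hb]; exact G.loopless.irrefl v
  have h2 := IA_coeff_two G A
  have key := key_alg hn hodd (IA G A) _ le_rfl h0 (by
    intro x hx
    have hx0 : x ≠ 0 := by
      rintro rfl
      rw [← coeff_zero_eq_aeval_zero', h0] at hx
      simp at hx
    refine root_form hodd x hx0 fun a b hab hab2 => ?_
    obtain ⟨m, rfl⟩ : ∃ m, n = m + 2 := ⟨n - 2, by omega⟩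
    rw [← cycle_eval m x a b hab hab2]
    obtain ⟨q, hq⟩ := hfac
    rw [hq, map_mul, hx, zero_mul])
  rw [Nat.cast_choose_two] at h2
  rw [h1] at key
  have : ((G.edgeFinset.filter fun e => ∀ v ∈ e, v ∈ A).card : ℚ) = A.card := by
    linear_combination h2 + key / 2
  exact_mod_cast this
end

section
/- Let n ≥ 4 and let G be a finite simple graph with I(G,x) = I(C_n,x). Then G has no isolated vertices, and the number of triangles in G satisfies n_G(C_3) = Σ_{i=3}^{n−1} C(i−1, 2) · g_i, where g_i is the number of vertices of G of degree i and C(a,2) is the binomial coefficient a choose 2. -/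
open Polynomial SimpleGraph

/-- `subgraphCount G H` : the number of subgraphs of `G` (not necessarily induced)
which are isomorphic to `H`. -/
noncomputable def subgraphCount {V W : Type*} [Fintype V] [Fintype W]
    (G : SimpleGraph V) (H : SimpleGraph W) : ℕ :=
  Nat.card {s : G.Subgraph // Nonempty (s.coe ≃g H)}


open scoped Classical in
theorem coeff_indep {V : Type*} [Fintype V] (G : SimpleGraph V) (k : ℕ) :
    G.indepPoly.coeff k = ((Finset.univ.filter fun s : Finset V => G.IsIndepFinset s ∧ s.card = k).card : ℚ) := by
  unfold SimpleGraph.indepPoly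
  rw [Polynomial.finsetSum_coeff, Finset.card_filter, Nat.cast_sum]
  refine Finset.sum_congr rfl fun s _ => ?_
  by_cases h1 : G.IsIndepFinset s <;> simp [h1, Polynomial.coeff_X_pow, eq_comm]

open scoped Classical in
/-- signed count of independent subsets of U -/
noncomputable def sgn {V : Type*} (G : SimpleGraph V) (U : Finset V) : ℚ :=
  ∑ s ∈ U.powerset, if G.IsIndepFinset s then (-1 : ℚ) ^ s.card else 0

open scoped Classical in
theorem sgn_insert {V : Type*} (G : SimpleGraph V) (U : Finset V) (v : V) (hv : v ∉ U) :
    sgn G (insert v U) = sgn G U - sgn G (U.filter fun w => ¬ G.Adj v w) := by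
  unfold sgn
  rw [Finset.sum_powerset_insert hv, sub_eq_add_neg]
  congr 1
  rw [← Finset.sum_neg_distrib]
  symm
  refine Finset.sum_subset_zero_on_sdiff ?_ ?_ ?_
  · exact Finset.powerset_mono.2 (Finset.filter_subset _ _)
  · intro s hs
    simp only [Finset.mem_sdiff, Finset.mem_powerset] at hs
    rw [if_neg]
    intro hi
    apply hs.2
    intro w hw
    exact Finset.mem_filter.2 ⟨hs.1 hw, hi v (by simp) w (by simp [hw])⟩
  · intro s hs
    simp only [Finset.mem_powerset] at hs
    have hvs : v ∉ s := fun h => hv (Finset.mem_filter.1 (hs h)).1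
    have : G.IsIndepFinset (insert v s) ↔ G.IsIndepFinset s := by
      constructor
      · intro h a ha b hb
        exact h a (by simp [ha]) b (by simp [hb])
      · intro h a ha b hb
        rcases Finset.mem_insert.1 ha with ha' | ha2 <;> rcases Finset.mem_insert.1 hb with hb' | hb2
        · subst ha' hb'; simp
        · subst ha'; exact (Finset.mem_filter.1 (hs hb2)).2
        · subst hb'; intro h; exact (Finset.mem_filter.1 (hs ha2)).2 h.symm
        · exact h a ha2 b hb2
    simp only [this, Finset.card_insert_of_notMem hvs]
    split_ifs
    · ring
    · simp

theorem sgn_step {V : Type*} (G : SimpleGraph V) (U U' W : Finset V) (v : V) (hv : v ∉ U)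
    (hU : ∀ w, w ∈ U' ↔ w = v ∨ w ∈ U) (hW : ∀ w, w ∈ W ↔ w ∈ U ∧ ¬ G.Adj v w) :
    sgn G U' = sgn G U - sgn G W := by
  classical
  have h1 : U' = insert v U := by ext w; simp [hU]
  have h2 : W = U.filter fun w => ¬ G.Adj v w := by ext w; simp [hW]
  have := sgn_insert G U v hv
  rw [h1, h2]
  convert this

theorem sgn_empty {V : Type*} (G : SimpleGraph V) : sgn G ∅ = 1 := by
  simp [sgn, SimpleGraph.IsIndepFinset]

theorem sgn_univ {V : Type*} [Fintype V] (G : SimpleGraph V) :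
    G.indepPoly.eval (-1) = sgn G Finset.univ := by
  classical
  unfold SimpleGraph.indepPoly sgn
  rw [Polynomial.eval_finsetSum, Finset.powerset_univ]
  refine Finset.sum_congr rfl fun s _ => ?_
  split_ifs <;> simp

theorem sgn_isolated {V : Type*} [Fintype V] (G : SimpleGraph V) (v : V) (hv : ∀ w, ¬ G.Adj v w) :
    sgn G Finset.univ = 0 := by
  classical
  have := sgn_step G (Finset.univ.erase v) Finset.univ (Finset.univ.erase v) v (by simp)
    (fun w => by simp; tauto) (fun w => by simp [hv])
  rw [this, sub_self]

def pp : ℕ → ℚ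
  | 0 => 1
  | 1 => 0
  | (k+2) => pp (k+1) - pp k

theorem pp_ne : ∀ m, pp (m+2) - pp m ≠ 0
  | 0 => by norm_num [pp]
  | 1 => by norm_num [pp]
  | 2 => by norm_num [pp]
  | (m+3) => by
    have := pp_ne m
    intro h
    apply this
    simp only [pp] at h ⊢
    linarith

theorem cyc_adj {n : ℕ} (hn : 3 ≤ n) (u v : Fin n) : (cycleGraph n).Adj u v ↔
    (u.val + 1 = v.val ∨ v.val + 1 = u.val ∨ (u.val = 0 ∧ v.val + 1 = n) ∨ (v.val = 0 ∧ u.val + 1 = n)) := by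
  rw [cycleGraph_adj']
  have hu := u.2
  have hv := v.2
  rw [Fin.val_sub, Fin.val_sub]
  have key : ∀ a b : ℕ, a < n → b < n → ((n - b + a) % n = 1 ↔ (b + 1 = a ∨ (a = 0 ∧ b + 1 = n))) := by
    intro a b ha hb
    by_cases h : b ≤ a
    · have : n - b + a = (a - b) + n := by omega
      rw [this, Nat.add_mod_right, Nat.mod_eq_of_lt (by omega)]
      omega
    · rw [Nat.mod_eq_of_lt (by omega)]
      omega
  rw [key _ _ hu hv, key _ _ hv hu]
  omega

noncomputable def seg (n a b : ℕ) : Finset (Fin n) := Finset.univ.filter fun i => a ≤ i.val ∧ i.val < b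

theorem seg_path {n : ℕ} (hn : 4 ≤ n) (a : ℕ) : ∀ k, a + k ≤ n → (k < n) → sgn (cycleGraph n) (seg n a (a+k)) = pp k
  | 0, _, _ => by
    have : seg n a (a+0) = ∅ := by ext; simp [seg]
    rw [this, sgn_empty]; rfl
  | 1, h, _ => by
    rw [sgn_step _ ∅ _ ∅ ⟨a, by omega⟩ (by simp) (fun i => by simp [seg, Fin.ext_iff]; omega) (by simp)]
    simp [pp]
  | (k+2), h, hk => by
    have i1 := seg_path hn a (k+1) (by omega) (by omega)
    have i2 := seg_path hn a k (by omega) (by omega)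
    rw [sgn_step _ (seg n a (a+(k+1))) _ (seg n a (a+k)) ⟨a+k+1, by omega⟩ (by simp [seg]; omega)
      (fun i => by simp [seg, Fin.ext_iff]; omega)
      (fun i => by rw [cyc_adj (by omega)]; simp [seg]; omega), i1, i2]
    rfl

theorem cyc_ne {n : ℕ} (hn : 4 ≤ n) : sgn (cycleGraph n) Finset.univ ≠ 0 := by
  obtain ⟨m, rfl⟩ : ∃ m, n = m + 3 := ⟨n - 3, by omega⟩
  rw [sgn_step _ (seg (m+3) 0 (0+(m+2))) _ (seg (m+3) 1 (1+m)) ⟨m+2, by omega⟩ (by simp [seg])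
      (fun i => by simp [seg, Fin.ext_iff]; omega)
      (fun i => by rw [cyc_adj (by omega)]; simp only [seg, Finset.mem_filter, Finset.mem_univ, true_and, and_true]; omega),
    seg_path hn 0 (m+2) (by omega) (by omega), seg_path hn 1 m (by omega) (by omega)]
  exact pp_ne m

theorem ordered_two {V : Type*} [Fintype V] [DecidableEq V] (R : V → V → Prop) [DecidableRel R]
    (hs : ∀ x y, R x y → R y x) (hi : ∀ x, ¬ R x x) (F : Finset (Finset V))
    (hF : ∀ s, s ∈ F ↔ s.card = 2 ∧ ∀ x ∈ s, ∀ y ∈ s, x ≠ y → R x y) :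
    (∑ x, ∑ y, if R x y then (1:ℤ) else 0) = 2 * F.card := by
  have h1 : (∑ x, ∑ y, if R x y then (1:ℤ) else 0)
      = ((Finset.univ.filter fun p : V × V => R p.1 p.2).card : ℤ) := by
    rw [Finset.card_filter, Nat.cast_sum, Fintype.sum_prod_type]; simp
  rw [h1, Finset.card_eq_sum_card_fiberwise (f := fun p : V × V => ({p.1, p.2} : Finset V)) (t := F)]
  · rw [Finset.sum_const_nat (m := 2)]
    · push_cast; ring
    · intro s hs'
      obtain ⟨hc, hR⟩ := (hF s).1 hs'
      obtain ⟨a, b, hab, rfl⟩ := Finset.card_eq_two.1 hc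
      have : (Finset.univ.filter fun p : V × V => R p.1 p.2).filter
          (fun p => ({p.1, p.2} : Finset V) = {a, b}) = {(a, b), (b, a)} := by
        have rab := hR a (by simp) b (by simp) hab
        ext ⟨x, y⟩
        simp only [Finset.mem_filter, Finset.mem_univ, true_and, Finset.mem_insert, Finset.mem_singleton, Prod.mk.injEq]
        constructor
        · rintro ⟨hr, he⟩
          have hx : x ∈ ({a, b} : Finset V) := by rw [← he]; simp
          have hy : y ∈ ({a, b} : Finset V) := by rw [← he]; simp
          simp at hx hy
          grind
        · rintro (⟨rfl, rfl⟩ | ⟨rfl, rfl⟩)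
          · exact ⟨rab, rfl⟩
          · exact ⟨hs _ _ rab, Finset.pair_comm _ _⟩
      rw [this, Finset.card_pair (by simp [hab])]
  · rintro ⟨x, y⟩ hp
    simp at hp
    have hne : x ≠ y := by rintro rfl; exact hi _ hp
    simp only [Finset.mem_coe, hF]
    refine ⟨Finset.card_pair hne, ?_⟩
    simp; grind

theorem ordered_three {V : Type*} [Fintype V] [DecidableEq V] (R : V → V → Prop) [DecidableRel R]
    (hs : ∀ x y, R x y → R y x) (hi : ∀ x, ¬ R x x) (F : Finset (Finset V))
    (hF : ∀ s, s ∈ F ↔ s.card = 3 ∧ ∀ x ∈ s, ∀ y ∈ s, x ≠ y → R x y) :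
    (∑ x, ∑ y, ∑ z, (if R x y then (1:ℤ) else 0) * (if R y z then (1:ℤ) else 0) *
      (if R x z then (1:ℤ) else 0)) = 6 * F.card := by
  have h1 : (∑ x, ∑ y, ∑ z, (if R x y then (1:ℤ) else 0) * (if R y z then (1:ℤ) else 0) *
      (if R x z then (1:ℤ) else 0))
      = ((Finset.univ.filter fun p : V × V × V => R p.1 p.2.1 ∧ R p.2.1 p.2.2 ∧ R p.1 p.2.2).card : ℤ) := by
    rw [Finset.card_filter, Nat.cast_sum, Fintype.sum_prod_type]
    refine Finset.sum_congr rfl fun x _ => ?_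
    rw [Fintype.sum_prod_type]
    refine Finset.sum_congr rfl fun y _ => Finset.sum_congr rfl fun z _ => ?_
    by_cases h1 : R x y <;> by_cases h2 : R y z <;> by_cases h3 : R x z <;> simp [h1, h2, h3]
  rw [h1, Finset.card_eq_sum_card_fiberwise
    (f := fun p : V × V × V => ({p.1, p.2.1, p.2.2} : Finset V)) (t := F)]
  · rw [Finset.sum_const_nat (m := 6)]
    · push_cast; ring
    · intro s hs'
      obtain ⟨hc, hR⟩ := (hF s).1 hs'
      obtain ⟨a, b, c, hab, hac, hbc, rfl⟩ := Finset.card_eq_three.1 hc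
      have : (Finset.univ.filter fun p : V × V × V => R p.1 p.2.1 ∧ R p.2.1 p.2.2 ∧ R p.1 p.2.2).filter
          (fun p => ({p.1, p.2.1, p.2.2} : Finset V) = {a, b, c}) =
          {(a, b, c), (a, c, b), (b, a, c), (b, c, a), (c, a, b), (c, b, a)} := by
        have rab := hR a (by simp) b (by simp) hab
        have rac := hR a (by simp) c (by simp) hac
        have rbc := hR b (by simp) c (by simp) hbc
        have rba := hs _ _ rab
        have rca := hs _ _ rac
        have rcb := hs _ _ rbc
        ext ⟨x, y, z⟩
        simp only [Finset.mem_filter, Finset.mem_univ, true_and, Finset.mem_insert, Finset.mem_singleton, Prod.mk.injEq]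
        constructor
        · rintro ⟨⟨hr1, hr2, hr3⟩, he⟩
          have hx : x ∈ ({a, b, c} : Finset V) := by rw [← he]; simp
          have hy : y ∈ ({a, b, c} : Finset V) := by rw [← he]; simp
          have hz : z ∈ ({a, b, c} : Finset V) := by rw [← he]; simp
          have n1 : x ≠ y := by rintro rfl; exact hi _ hr1
          have n2 : y ≠ z := by rintro rfl; exact hi _ hr2
          have n3 : x ≠ z := by rintro rfl; exact hi _ hr3
          clear he hR hF h1
          simp only [Finset.mem_insert, Finset.mem_singleton] at hx hy hz
          rcases hx with rfl | rfl | rfl <;> rcases hy with rfl | rfl | rfl <;>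
            rcases hz with rfl | rfl | rfl <;> simp_all
        · rintro (⟨rfl, rfl, rfl⟩ | ⟨rfl, rfl, rfl⟩ | ⟨rfl, rfl, rfl⟩ | ⟨rfl, rfl, rfl⟩ | ⟨rfl, rfl, rfl⟩ | ⟨rfl, rfl, rfl⟩) <;>
          · refine ⟨⟨by assumption, by assumption, by assumption⟩, ?_⟩
            ext w; simp; try tauto
      rw [this]
      have := hab.symm
      have := hac.symm
      have := hbc.symm
      simp [*]
  · rintro ⟨x, y, z⟩ hp
    simp at hp
    obtain ⟨r1, r2, r3⟩ := hp
    have n1 : x ≠ y := by rintro rfl; exact hi _ r1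
    have n2 : y ≠ z := by rintro rfl; exact hi _ r2
    have n3 : x ≠ z := by rintro rfl; exact hi _ r3
    simp only [Finset.mem_coe, hF]
    refine ⟨Finset.card_eq_three.2 ⟨x, y, z, n1, n3, n2, rfl⟩, ?_⟩
    have := hs _ _ r1
    have := hs _ _ r2
    have := hs _ _ r3
    simp [*]

open scoped Classical in
theorem indep_two {V : Type*} [Fintype V] (G : SimpleGraph V) :
    2 * ((Finset.univ.filter fun s : Finset V => G.IsIndepFinset s ∧ s.card = 2).card : ℤ)
      = (Fintype.card V : ℤ)^2 - Fintype.card V - ∑ v, (G.degree v : ℤ) := by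
  rw [← ordered_two (fun x y => x ≠ y ∧ ¬ G.Adj x y) (fun x y h => ⟨h.1.symm, fun h' => h.2 h'.symm⟩)
    (by simp)]
  · have h1 : ∀ x y : V, (if x ≠ y ∧ ¬ G.Adj x y then (1:ℤ) else 0) =
      1 - (if x = y then 1 else 0) - (if G.Adj x y then 1 else 0) := by
      intro x y
      by_cases h : x = y
      · subst h; simp
      · by_cases h' : G.Adj x y <;> simp [h, h']
    have h2 : ∀ x : V, ∑ y, (if G.Adj x y then (1:ℤ) else 0) = G.degree x := by
      intro x
      rw [← G.card_neighborFinset_eq_degree, neighborFinset_eq_filter]; simp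
    simp only [h1, Finset.sum_sub_distrib, h2]
    simp [sq]
  · intro s
    rw [Finset.mem_filter]
    simp only [Finset.mem_univ, true_and, SimpleGraph.IsIndepFinset]
    constructor
    · rintro ⟨h1, h2⟩
      exact ⟨h2, fun x hx y hy hxy => ⟨hxy, h1 x hx y hy⟩⟩
    · rintro ⟨h1, h2⟩
      refine ⟨fun x hx y hy h => (h2 x hx y hy h.ne).2 h, h1⟩

open scoped Classical in
theorem indep_three {V : Type*} [Fintype V] (G : SimpleGraph V) :
    6 * ((Finset.univ.filter fun s : Finset V => G.IsIndepFinset s ∧ s.card = 3).card : ℤ)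
      = (Fintype.card V : ℤ)^3 - 3 * Fintype.card V * (Fintype.card V + ∑ v, (G.degree v : ℤ))
        + 3 * ∑ v, ((1:ℤ) + G.degree v)^2 - Fintype.card V - 3 * ∑ v, (G.degree v : ℤ)
        - 6 * (G.cliqueFinset 3).card := by
  have hT := ordered_three (fun x y => G.Adj x y) (fun x y h => h.symm)
    (by simp) (G.cliqueFinset 3) (fun s => by
      rw [mem_cliqueFinset_iff, isNClique_iff, IsClique, Set.Pairwise]
      simp; tauto)
  rw [← hT, ← ordered_three (fun x y => x ≠ y ∧ ¬ G.Adj x y) (fun x y h => ⟨h.1.symm, fun h' => h.2 h'.symm⟩)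
    (by simp)]
  · set d : V → V → ℤ := fun x y => if x = y then 1 else 0 with hd
    set e : V → V → ℤ := fun x y => if G.Adj x y then 1 else 0 with he
    set b : V → V → ℤ := fun x y => d x y + e x y with hb
    have h1 : ∀ x y : V, (if x ≠ y ∧ ¬ G.Adj x y then (1:ℤ) else 0) = 1 - b x y := by
      intro x y
      simp only [hb, hd, he]
      by_cases h : x = y
      · subst h; simp
      · by_cases h' : G.Adj x y <;> simp [h, h']
    have bs : ∀ x y, b x y = b y x := by
      intro x y; simp only [hb, hd, he, G.adj_comm, eq_comm]
    have se : ∀ x : V, ∑ y, e x y = G.degree x := by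
      intro x
      rw [← G.card_neighborFinset_eq_degree, neighborFinset_eq_filter]; simp [he]
    have sd : ∀ x : V, ∑ y, d x y = 1 := by
      intro x; simp [hd]
    have sb : ∀ x : V, ∑ y, b x y = 1 + G.degree x := by
      intro x; simp only [hb, Finset.sum_add_distrib, se, sd]
    have sb' : ∀ x : V, ∑ y, b y x = 1 + G.degree x := by
      intro x; rw [← sb]; exact Finset.sum_congr rfl fun y _ => bs _ _
    have p1 : ∀ x y z, b x y * b y z * b x z = d x y * b x z + d y z * e x y + d x z * e x y
        + e x y * e y z * e x z := by
      intro x y z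
      simp only [hb, hd, he]
      by_cases hxy : x = y
      · subst hxy
        by_cases hxz : x = z
        · subst hxz; simp
        · by_cases h' : G.Adj x z <;> simp [hxz, h']
      · by_cases hyz : y = z
        · subst hyz
          by_cases h' : G.Adj x y <;> simp [hxy, h']
        · by_cases hxz : x = z
          · subst hxz
            by_cases h' : G.Adj x y <;> simp [hxy, hyz, h', G.adj_comm y x]
          · simp [hxy, hyz, hxz]
    have p2 : ∀ x y z, (1 - b x y) * (1 - b y z) * (1 - b x z) =
        1 - b x y - b y z - b x z + b y x * b y z + b z y * b z x + b x y * b x z -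
        (d x y * b x z + d y z * e x y + d x z * e x y + e x y * e y z * e x z) := by
      intro x y z
      rw [← p1, bs y x, bs z y, bs z x]; ring
    simp only [h1, p2, Finset.sum_add_distrib, Finset.sum_sub_distrib]
    set N : ℤ := (Fintype.card V : ℤ) with hN
    set S : ℤ := ∑ v, (G.degree v : ℤ) with hS
    have q0 : ∑ x : V, ∑ y : V, ∑ z : V, (1:ℤ) = N^3 := by simp [hN]; ring
    have sbb : ∑ x, ∑ y, b x y = N + S := by
      simp only [sb, Finset.sum_add_distrib]; simp [hN, hS]
    have see : ∑ x, ∑ y, e x y = S := by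
      simp only [se, hS]
    have q1 : ∑ x : V, ∑ y : V, ∑ z : V, b x y = N * (N + S) := by
      simp only [Finset.sum_const, ← Finset.smul_sum, sbb]; simp [hN]
    have q2 : ∑ x : V, ∑ y : V, ∑ z : V, b y z = N * (N + S) := by
      simp only [sbb]; simp [hN]
    have q3 : ∑ x : V, ∑ y : V, ∑ z : V, b x z = N * (N + S) := by
      simp only [Finset.sum_const, ← Finset.smul_sum, sbb]; simp [hN]
    have q4 : ∑ x : V, ∑ y : V, ∑ z : V, b x y * b x z = ∑ v, ((1:ℤ) + G.degree v)^2 := by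
      simp only [← Finset.mul_sum, ← Finset.sum_mul, sb, sq]
    have q5 : ∑ x : V, ∑ y : V, ∑ z : V, b y x * b y z = ∑ v, ((1:ℤ) + G.degree v)^2 := by
      rw [Finset.sum_comm, q4]
    have q6 : ∑ x : V, ∑ y : V, ∑ z : V, b z y * b z x = ∑ v, ((1:ℤ) + G.degree v)^2 := by
      rw [← q5, Finset.sum_comm]
      refine Finset.sum_congr rfl fun y _ => ?_
      rw [Finset.sum_comm]
    have q7 : ∑ x : V, ∑ y : V, ∑ z : V, d x y * b x z = N + S := by
      simp only [← Finset.mul_sum, ← Finset.sum_mul, sd, one_mul, sbb]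
    have q8 : ∑ x : V, ∑ y : V, ∑ z : V, d y z * e x y = S := by
      simp only [← Finset.sum_mul, sd, one_mul, see]
    have q9 : ∑ x : V, ∑ y : V, ∑ z : V, d x z * e x y = S := by
      simp only [← Finset.sum_mul, sd, one_mul, see]
    rw [q0, q1, q2, q3, q4, q5, q6, q7, q8, q9]
    ring
  · intro s
    rw [Finset.mem_filter]
    simp only [Finset.mem_univ, true_and, SimpleGraph.IsIndepFinset]
    constructor
    · rintro ⟨h1, h2⟩
      exact ⟨h2, fun x hx y hy hxy => ⟨hxy, h1 x hx y hy⟩⟩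
    · rintro ⟨h1, h2⟩
      refine ⟨fun x hx y hy h => (h2 x hx y hy h.ne).2 h, h1⟩

open scoped Classical in
theorem subgraph_three {V : Type*} [Fintype V] (G : SimpleGraph V) :
    subgraphCount G (cycleGraph 3) = (G.cliqueFinset 3).card := by
  unfold subgraphCount
  rw [cycleGraph_three_eq_top, ← Fintype.card_coe, ← Nat.card_eq_fintype_card]
  have key : ∀ s : G.Subgraph, Nonempty (s.coe ≃g (⊤ : SimpleGraph (Fin 3))) →
      s.verts.toFinset.card = 3 ∧ ∀ a b, s.Adj a b ↔ a ∈ s.verts ∧ b ∈ s.verts ∧ a ≠ b := by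
    rintro s ⟨f⟩
    constructor
    · rw [Set.toFinset_card, Fintype.card_congr f.toEquiv]; simp
    · intro a b
      constructor
      · intro h; exact ⟨h.fst_mem, h.snd_mem, h.ne⟩
      · rintro ⟨ha, hb, hab⟩
        have : s.coe.Adj ⟨a, ha⟩ ⟨b, hb⟩ := by
          rw [← f.map_adj_iff, top_adj]
          intro h
          exact hab (congrArg Subtype.val (f.injective h))
        exact this
  refine Nat.card_congr (Equiv.ofBijective
    (fun s => ⟨s.1.verts.toFinset, ?_⟩) ⟨?_, ?_⟩)
  · rw [mem_cliqueFinset_iff, isNClique_iff]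
    obtain ⟨h1, h2⟩ := key s.1 s.2
    refine ⟨?_, h1⟩
    intro a ha b hb hab
    exact s.1.adj_sub ((h2 a b).2 ⟨by simpa using ha, by simpa using hb, hab⟩)
  · rintro ⟨s, hs⟩ ⟨t, ht⟩ h
    have hv : s.verts = t.verts := by
      simpa using h
    apply Subtype.ext
    refine Subgraph.ext hv ?_
    funext a b
    rw [eq_iff_iff, (key s hs).2, (key t ht).2, hv]
  · rintro ⟨s, hs⟩
    rw [mem_cliqueFinset_iff, isNClique_iff] at hs
    refine ⟨⟨(⊤ : G.Subgraph).induce (s : Set V), ?_⟩, ?_⟩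
    · have hc : Fintype.card ((⊤ : G.Subgraph).induce (s : Set V)).verts = Fintype.card (Fin 3) := by
        simp [hs.2]
      refine ⟨⟨Fintype.equivOfCardEq hc, ?_⟩⟩
      rintro ⟨a, ha⟩ ⟨b, hb⟩
      simp at ha hb
      simp [ha, hb]
      constructor
      · intro h; exact hs.1 ha hb h
      · intro h; exact h.ne
    · simp

open scoped Classical in
theorem coeffs {V W : Type*} [Fintype V] [Fintype W] (G : SimpleGraph V) (H : SimpleGraph W)
    (h : G.indepPoly = H.indepPoly) (k : ℕ) :
    (Finset.univ.filter fun s : Finset V => G.IsIndepFinset s ∧ s.card = k).card =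
    (Finset.univ.filter fun s : Finset W => H.IsIndepFinset s ∧ s.card = k).card := by
  have := congrArg (fun p => Polynomial.coeff p k) h
  simp only [coeff_indep] at this
  exact_mod_cast this

open scoped Classical in
theorem indep_one {V : Type*} [Fintype V] (G : SimpleGraph V) :
    (Finset.univ.filter fun s : Finset V => G.IsIndepFinset s ∧ s.card = 1).card = Fintype.card V := by
  rw [← Finset.card_univ, ← Nat.choose_one_right (Finset.univ : Finset V).card, ← Finset.card_powersetCard]
  congr 1
  ext s
  simp only [Finset.mem_filter, Finset.mem_univ, true_and, Finset.mem_powersetCard, Finset.subset_univ]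
  refine ⟨fun h => h.2, fun h => ⟨?_, h⟩⟩
  obtain ⟨a, rfl⟩ := Finset.card_eq_one.1 h
  simp [SimpleGraph.IsIndepFinset]

open scoped Classical in
/-- For `n ≥ 4`, if `I(G,x) = I(C_n,x)` then `G` has no isolated vertices and the number
of triangles of `G` is `Σ_{i=3}^{n-1} C(i-1,2)·g_i` where `g_i` is the number of
vertices of degree `i`. -/
theorem triangle_count_eq {n : ℕ} (hn : 4 ≤ n) {V : Type} [Fintype V] (G : SimpleGraph V)
    (h : G.indepPoly = (cycleGraph n).indepPoly) :
    (∀ v : V, 0 < G.degree v) ∧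
    subgraphCount G (cycleGraph 3) =
      ∑ i ∈ Finset.Icc 3 (n - 1),
        Nat.choose (i - 1) 2 * (Finset.univ.filter fun v : V => G.degree v = i).card := by
  have hpos : ∀ v : V, 0 < G.degree v := by
    intro v
    rw [Nat.pos_iff_ne_zero]
    intro h0
    refine cyc_ne hn ?_
    rw [← sgn_univ, ← h, sgn_univ]
    apply sgn_isolated G v
    intro w hw
    have : 0 < G.degree v := (G.degree_pos_iff_exists_adj v).2 ⟨w, hw⟩
    omega
  refine ⟨hpos, ?_⟩
  have c1 := coeffs _ _ h 1
  have c2 := coeffs _ _ h 2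
  have c3 := coeffs _ _ h 3
  rw [indep_one, indep_one, Fintype.card_fin] at c1
  have dC : ∀ (v : Fin n) (_ : Fintype ((cycleGraph n).neighborSet v)), (cycleGraph n).degree v = 2 := by
    obtain ⟨m, rfl⟩ : ∃ m, n = m + 3 := ⟨n - 3, by omega⟩
    intro v _
    rw [← cycleGraph_degree_three_le (v := v)]
    congr!
  have tC : ∀ (_ : DecidableEq (Fin n)) (_ : DecidableRel (cycleGraph n).Adj), ((cycleGraph n).cliqueFinset 3).card = 0 := by
    intro _ _
    rw [Finset.card_eq_zero, cliqueFinset_eq_empty_iff]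
    intro s hs
    obtain ⟨a, b, c, hab, hac, hbc, -⟩ := is3Clique_iff.1 hs
    rw [cyc_adj (by omega)] at hab hac hbc
    omega
  have e2 := indep_two G
  have e2' := indep_two (cycleGraph n)
  have e3 := indep_three G
  have e3' := indep_three (cycleGraph n)
  rw [c2, e2'] at e2
  rw [c3, e3'] at e3
  simp only [dC, tC, c1, Fintype.card_fin, Finset.sum_const, Finset.card_univ, nsmul_eq_mul] at e2 e3
  have hS : ∑ v, (G.degree v : ℤ) = 2 * n := by push_cast at e2; linarith
  rw [hS] at e3
  have hexp : ∑ v, ((1:ℤ) + G.degree v)^2 = n + 2 * (2 * n) + ∑ v, (G.degree v : ℤ)^2 := by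
    rw [← hS, Finset.mul_sum]
    have : (n : ℤ) = ∑ v : V, (1:ℤ) := by simp [c1]
    rw [this, ← Finset.sum_add_distrib, ← Finset.sum_add_distrib]
    exact Finset.sum_congr rfl fun v _ => by ring
  rw [hexp] at e3
  have hsum : ∑ i ∈ Finset.Icc 3 (n - 1),
        Nat.choose (i - 1) 2 * (Finset.univ.filter fun v : V => G.degree v = i).card
      = ∑ v, Nat.choose (G.degree v - 1) 2 := by
    have hlt : ∀ v, G.degree v < n := fun v => c1 ▸ G.degree_lt_card_verts v
    simp only [Finset.card_filter, Finset.mul_sum]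
    rw [Finset.sum_comm]
    refine Finset.sum_congr rfl fun v _ => ?_
    simp only [mul_ite, mul_one, mul_zero, Finset.sum_ite_eq]
    split_ifs with hm
    · rfl
    · symm
      apply Nat.choose_eq_zero_of_lt
      have := hlt v
      simp only [Finset.mem_Icc] at hm
      omega
  rw [hsum, subgraph_three]
  have hch : ∀ v, 2 * ((Nat.choose (G.degree v - 1) 2 : ℕ) : ℤ) = (G.degree v : ℤ)^2 - 3 * G.degree v + 2 := by
    intro v
    obtain ⟨k, hk⟩ : ∃ k, G.degree v = k + 1 := ⟨G.degree v - 1, by have := hpos v; omega⟩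
    rw [hk, Nat.add_sub_cancel]
    have hq : ((Nat.choose k 2 : ℕ) : ℚ) = k * (k - 1) / 2 := Nat.cast_choose_two ℚ k
    have : (2 * ((Nat.choose k 2 : ℕ) : ℚ)) = ((k + 1 : ℕ) : ℚ)^2 - 3 * ((k + 1 : ℕ) : ℚ) + 2 := by
      rw [hq]; push_cast; ring
    exact_mod_cast this
  have hfin : 2 * (∑ v, ((Nat.choose (G.degree v - 1) 2 : ℕ) : ℤ)) = ∑ v, (G.degree v : ℤ)^2 - 3 * (2 * n) + 2 * n := by
    rw [Finset.mul_sum, Finset.sum_congr rfl fun v _ => hch v, Finset.sum_add_distrib, Finset.sum_sub_distrib,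
      ← Finset.mul_sum, hS]
    simp [c1, mul_comm]
  zify
  push_cast at e3
  linarith
end

section
/- Let n ≥ 4 and let G be a finite simple graph with I(G,x) = I(C_n,x). Then the maximum degree of G is at most 3, and the number of triangles in G equals the number of vertices of G of degree 3, i.e. n_G(C_3) = g_3. -/
open Polynomial SimpleGraph

namespace IndepCyc
open scoped Classical
set_option autoImplicit false
set_option linter.unusedSectionVars false
set_option linter.unusedVariables false

noncomputable def J {V : Type} [Fintype V] (G : SimpleGraph V) (S : Finset V) : ℚ[X] :=
  ∑ s ∈ S.powerset, if G.IsIndepFinset s then (X : ℚ[X]) ^ s.card else 0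

variable {V : Type} [Fintype V] (G : SimpleGraph V)

lemma J_univ : G.indepPoly = J G Finset.univ := by
  unfold SimpleGraph.indepPoly J
  rw [Finset.powerset_univ]

lemma J_empty : J G ∅ = 1 := by
  simp [J, SimpleGraph.IsIndepFinset]

lemma indep_insert {v : V} {t : Finset V} :
    G.IsIndepFinset (insert v t) ↔ G.IsIndepFinset t ∧ ∀ w ∈ t, ¬ G.Adj v w := by
  unfold SimpleGraph.IsIndepFinset
  constructor
  · intro h
    exact ⟨fun a ha b hb => h a (Finset.mem_insert_of_mem ha) b (Finset.mem_insert_of_mem hb),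
      fun w hw => h v (Finset.mem_insert_self _ _) w (Finset.mem_insert_of_mem hw)⟩
  · rintro ⟨h1, h2⟩ a ha b hb hab
    rcases Finset.mem_insert.1 ha with rfl | ha' <;> rcases Finset.mem_insert.1 hb with rfl | hb'
    · exact G.loopless.irrefl _ hab
    · exact h2 b hb' hab
    · exact h2 a ha' hab.symm
    · exact h1 a ha' b hb' hab

lemma J_insert {v : V} {S : Finset V} (hv : v ∉ S) :
    J G (insert v S) = J G S + X * J G (S.filter fun w => ¬ G.Adj v w) := by
  unfold J
  rw [Finset.sum_powerset_insert hv]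
  congr 1
  rw [Finset.mul_sum]
  symm
  have hsub : (S.filter fun w => ¬ G.Adj v w).powerset ⊆ S.powerset :=
    Finset.powerset_mono.2 (Finset.filter_subset _ _)
  rw [← Finset.sum_subset hsub (f := fun t => if G.IsIndepFinset (insert v t) then (X : ℚ[X]) ^ (insert v t).card else 0)]
  · refine Finset.sum_congr rfl fun t ht => ?_
    have ht' := Finset.mem_powerset.1 ht
    have hvt : v ∉ t := fun h => hv (Finset.mem_filter.1 (ht' h)).1
    have h2 : ∀ w ∈ t, ¬ G.Adj v w := fun w hw => (Finset.mem_filter.1 (ht' hw)).2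
    rw [indep_insert, Finset.card_insert_of_notMem hvt]
    by_cases h : G.IsIndepFinset t
    · rw [if_pos h, if_pos ⟨h, h2⟩, pow_succ, mul_comm]
    · rw [if_neg h, if_neg (fun h' => h h'.1), mul_zero]
  · intro t ht hnt
    rw [if_neg]
    rw [indep_insert]
    rintro ⟨_, h2⟩
    exact hnt (Finset.mem_powerset.2 fun w hw =>
      Finset.mem_filter.2 ⟨Finset.mem_powerset.1 ht hw, h2 w hw⟩)

/-- deletion with explicit remainders -/
lemma J_del {v : V} {S A B : Finset V} (hS : ∀ w, w ∈ S ↔ w = v ∨ w ∈ A) (hv : v ∉ A)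
    (hB : ∀ w, w ∈ B ↔ w ∈ A ∧ ¬ G.Adj v w) : J G S = J G A + X * J G B := by
  have h1 : S = insert v A := by ext w; simp [hS]
  have h2 : B = A.filter fun w => ¬ G.Adj v w := by ext w; simp [hB]
  rw [h1, h2, J_insert G hv]

lemma J_deriv (S : Finset V) :
    derivative (J G S) = ∑ v ∈ S, J G (S.filter fun w => w ≠ v ∧ ¬ G.Adj v w) := by
  induction hn : S.card using Nat.strong_induction_on generalizing S with
  | _ n ih =>
  rcases S.eq_empty_or_nonempty with rfl | ⟨v, hv⟩
  · simp [J_empty]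
  · obtain ⟨A, hvA, rfl⟩ : ∃ A, v ∉ A ∧ S = insert v A :=
      ⟨S.erase v, Finset.notMem_erase _ _, (Finset.insert_erase hv).symm⟩
    rw [Finset.card_insert_of_notMem hvA] at hn
    rw [J_insert G hvA, derivative_add, derivative_mul, derivative_X, ih _ (by omega) A rfl,
      ih _ (lt_of_le_of_lt (Finset.card_filter_le A _) (by omega)) (A.filter _) rfl,
      Finset.sum_insert hvA, Finset.sum_filter, one_mul]
    have e1 : (insert v A).filter (fun w => w ≠ v ∧ ¬ G.Adj v w) = A.filter fun w => ¬ G.Adj v w := by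
      ext w; simp only [Finset.mem_filter, Finset.mem_insert]
      constructor
      · rintro ⟨h | h, h2, h3⟩
        · exact absurd h h2
        · exact ⟨h, h3⟩
      · rintro ⟨h, h3⟩
        exact ⟨Or.inr h, fun e => hvA (e ▸ h), h3⟩
    rw [e1]
    have key : ∀ u ∈ A, J G ((insert v A).filter fun w => w ≠ u ∧ ¬ G.Adj u w) =
        J G (A.filter fun w => w ≠ u ∧ ¬ G.Adj u w) + X * (if ¬ G.Adj v u then
          J G ((A.filter fun w => ¬ G.Adj v w).filter fun w => w ≠ u ∧ ¬ G.Adj u w) else 0) := by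
      intro u hu
      have huv : v ≠ u := fun e => hvA (e ▸ hu)
      by_cases h : G.Adj v u
      · have : (insert v A).filter (fun w => w ≠ u ∧ ¬ G.Adj u w) = A.filter fun w => w ≠ u ∧ ¬ G.Adj u w := by
          rw [Finset.filter_insert, if_neg]
          exact fun h' => h'.2 h.symm
        simp [this, h]
      · rw [if_pos h]
        apply J_del G (v := v)
        · intro w
          rw [Finset.filter_insert, if_pos ⟨huv, fun h' => h h'.symm⟩, Finset.mem_insert]
        · simp [hvA]
        · intro w; simp only [Finset.mem_filter]; tauto
    rw [Finset.sum_congr rfl key, Finset.sum_add_distrib, ← Finset.mul_sum]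
    ring

/-- values on the reals -/
noncomputable def ev (S : Finset V) (x : ℝ) : ℝ := aeval x (J G S)

lemma ev_empty (x : ℝ) : ev G ∅ x = 1 := by simp [ev, J_empty]

lemma ev_insert {v : V} {S : Finset V} (hv : v ∉ S) (x : ℝ) :
    ev G (insert v S) x = ev G S x + x * ev G (S.filter fun w => ¬ G.Adj v w) x := by
  simp [ev, J_insert G hv]

lemma ev_cont (S : Finset V) : Continuous (ev G S) := by
  unfold ev; exact Polynomial.continuous_aeval _

lemma ev_pos (S : Finset V) : ∀ r : ℝ, (∀ x ∈ Set.Icc r 0, 0 < ev G S x) → ∀ T ⊆ S,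
    ∀ x ∈ Set.Icc r 0, 0 < ev G T x := by
  induction hn : S.card using Nat.strong_induction_on generalizing S with
  | _ n ih =>
  intro r hr T hT
  by_cases hTS : T = S
  · rw [hTS]; exact hr
  obtain ⟨v, hvS, hvT⟩ : ∃ v ∈ S, v ∉ T := by
    by_contra! hcon
    exact hTS (Finset.Subset.antisymm hT hcon)
  obtain ⟨A, hvA, rfl⟩ : ∃ A, v ∉ A ∧ S = insert v A :=
    ⟨S.erase v, Finset.notMem_erase _ _, (Finset.insert_erase hvS).symm⟩
  rw [Finset.card_insert_of_notMem hvA] at hn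
  have hTA : T ⊆ A := fun w hw => by
    rcases Finset.mem_insert.1 (hT hw) with rfl | h
    · exact absurd hw hvT
    · exact h
  have hA : ∀ x ∈ Set.Icc r 0, 0 < ev G A x := by
    by_contra! hcon
    have hc : IsCompact (Set.Icc r 0 ∩ {x | ev G A x ≤ 0}) :=
      isCompact_Icc.inter_right (isClosed_le (ev_cont G A) continuous_const)
    obtain ⟨y, hy⟩ := hcon
    obtain ⟨x0, hx0, hmax⟩ := hc.exists_isGreatest ⟨y, hy⟩
    have hgt : ∀ x, x0 < x → x ≤ 0 → 0 < ev G A x := by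
      intro x h1 h2
      by_contra! h3
      have := hmax ⟨⟨hx0.1.1.trans h1.le, h2⟩, h3⟩
      linarith
    have hx0neg : x0 < 0 := by
      rcases lt_or_eq_of_le hx0.1.2 with h | h
      · exact h
      · exfalso
        have h2 : ev G A x0 ≤ 0 := hx0.2
        have h1 := hr x0 hx0.1
        rw [ev_insert G hvA] at h1
        rw [h] at h1 h2
        linarith
    have hB : ∀ x ∈ Set.Ioc x0 0, 0 < ev G (A.filter fun w => ¬ G.Adj v w) x := by
      intro x hx
      exact ih _ (by omega) A rfl x (fun z hz => hgt z (lt_of_lt_of_le hx.1 hz.1) hz.2) _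
        (Finset.filter_subset _ _) x ⟨le_rfl, hx.2⟩
    have hB0 : 0 ≤ ev G (A.filter fun w => ¬ G.Adj v w) x0 := by
      have hcl : IsClosed {x | 0 ≤ ev G (A.filter fun w => ¬ G.Adj v w) x} :=
        isClosed_le continuous_const (ev_cont G _)
      have hsub : closure (Set.Ioc x0 0) ⊆ {x | 0 ≤ ev G (A.filter fun w => ¬ G.Adj v w) x} :=
        hcl.closure_subset_iff.2 fun x hx => (hB x hx).le
      apply hsub
      rw [closure_Ioc hx0neg.ne]
      exact ⟨le_rfl, hx0neg.le⟩
    have h1 := hr x0 hx0.1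
    rw [ev_insert G hvA] at h1
    have h2 : ev G A x0 ≤ 0 := hx0.2
    nlinarith
  exact ih _ (by omega) A rfl r hA T hTA

/-! path polynomials -/
noncomputable def p : ℕ → ℚ[X]
  | 0 => 1
  | 1 => 1 + X
  | (k+2) => p (k+1) + X * p k

lemma p_add_two (k : ℕ) : p (k+2) = p (k+1) + X * p k := by rw [p]

lemma D_formula (k : ℕ) : derivative (p (k+2) + X * p k) = (k + 3 : ℚ[X]) * p k := by
  induction k using Nat.strong_induction_on with
  | _ k ih =>
  match k with
  | 0 => simp [p]; ring
  | 1 => simp [p]; ring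
  | k+2 =>
    have h0 := ih k (by omega)
    have h1 := ih (k+1) (by omega)
    have e : p (k+2+2) + X * p (k+2) = (p (k+1+2) + X * p (k+1)) + X * (p (k+2) + X * p k) := by
      rw [p_add_two (k+2), p_add_two k, show k+1+2 = k+2+1 from rfl]; ring
    rw [e, derivative_add, derivative_mul, h0, h1, derivative_X, p_add_two k]
    push_cast
    ring

lemma p_coprime (k : ℕ) (x : ℚ) (hx : x ≠ 0) : ¬ ((p k).eval x = 0 ∧ (p (k+1)).eval x = 0) := by
  induction k with
  | zero => simp [p]
  | succ k ih =>
    rintro ⟨h1, h2⟩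
    rw [p_add_two] at h2
    simp only [eval_add, eval_mul, eval_X, h1, zero_add, mul_eq_zero, hx, false_or] at h2
    exact ih ⟨h2, h1⟩

lemma p_pos (x : ℝ) (hx : x ∈ Set.Icc (-1/4 : ℝ) 0) (k : ℕ) :
    0 < aeval x (p k) ∧ aeval x (p k) / 2 < aeval x (p (k+1)) := by
  obtain ⟨h1, h2⟩ := hx
  induction k with
  | zero => simp [p]; linarith
  | succ k ih =>
    rw [p_add_two]
    simp only [map_add, map_mul, aeval_X]
    constructor
    · linarith
    · nlinarith

lemma C_pos (x : ℝ) (hx : x ∈ Set.Icc (-1/4 : ℝ) 0) (k : ℕ) :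
    0 < aeval x (p (k+2) + X * p k) := by
  have h1 := p_pos x hx k
  have h2 := p_pos x hx (k+1)
  simp only [map_add, map_mul, aeval_X]
  obtain ⟨hx1, hx2⟩ := hx
  nlinarith

lemma p_neg_one (k : ℕ) : ((p k).eval (-1), (p (k+1)).eval (-1)) ∈
    ({(1,0),(0,-1),(-1,-1),(-1,0),(0,1),(1,1)} : Set (ℚ × ℚ)) := by
  induction k with
  | zero => simp [p]
  | succ k ih =>
    rw [p_add_two]
    simp only [eval_add, eval_mul, eval_X]
    simp only [Set.mem_insert_iff, Set.mem_singleton_iff, Prod.mk.injEq] at ih ⊢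
    rcases ih with h | h | h | h | h | h <;> rw [h.1, h.2] <;> norm_num

lemma C_neg_one (k : ℕ) : (p (k+2) + X * p k).eval (-1) ≠ 0 := by
  have ih := p_neg_one k
  rw [p_add_two]
  simp only [eval_add, eval_mul, eval_X]
  simp only [Set.mem_insert_iff, Set.mem_singleton_iff, Prod.mk.injEq] at ih
  rcases ih with h | h | h | h | h | h <;> rw [h.1, h.2] <;> norm_num

lemma C_third (k : ℕ) (Q : ℚ[X]) : p (k+2) + X * p k ≠ (1 + 3 * X)^2 * Q := by
  intro h
  have hD := D_formula k
  have h1 := congrArg (eval (-(1/3))) h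
  rw [h] at hD
  have h2 := congrArg (eval (-(1/3))) hD
  have e3 : (3 : ℚ[X]) = C 3 := rfl
  simp [derivative_mul, derivative_pow, e3] at h2
  have hp : (p k).eval (-(1/3)) = 0 := by
    have hk : (k + 3 : ℚ) ≠ 0 := by positivity
    norm_num at h2
    exact h2.resolve_left hk
  simp [e3] at h1
  rw [p_add_two] at h1
  simp only [eval_add, eval_mul] at h1
  norm_num at h1
  exact p_coprime k (-(1/3)) (by norm_num) ⟨hp, by linarith⟩

lemma p_zero (k : ℕ) : (p k).eval 0 = 1 := by
  induction k using Nat.strong_induction_on with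
  | _ k ih =>
  match k with
  | 0 => simp [p]
  | 1 => simp [p]
  | k+2 => rw [p_add_two]; simp [ih (k+1) (by omega)]

lemma p_d1 (k : ℕ) : (derivative (p k)).eval 0 = k := by
  induction k using Nat.strong_induction_on with
  | _ k ih =>
  match k with
  | 0 => simp [p]
  | 1 => simp [p]
  | k+2 => rw [p_add_two]; simp [ih (k+1) (by omega), p_zero]; ring

lemma p_d2 (k : ℕ) : (derivative (derivative (p (k+1)))).eval 0 = k * (k - 1) := by
  induction k with
  | zero => simp [p]
  | succ k ih => rw [p_add_two]; simp [ih, p_d1]; ring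

end IndepCyc

namespace IndepCyc
open scoped Classical
set_option autoImplicit false
set_option linter.unusedSectionVars false
set_option linter.unusedVariables false

lemma cyc_adj {n : ℕ} (hn : 4 ≤ n) (u v : Fin n) : (cycleGraph n).Adj u v ↔
    (u.val + 1 = v.val ∨ v.val + 1 = u.val ∨ (u.val = 0 ∧ v.val + 1 = n) ∨
      (v.val = 0 ∧ u.val + 1 = n)) := by
  have key : ∀ u v : Fin n, (u - v).val = if v.val ≤ u.val then u.val - v.val else n - v.val + u.val := by
    intro u v
    have hu := u.2
    have hv := v.2
    rw [Fin.sub_def]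
    simp only
    split_ifs with h
    · have : n - v.val + u.val = (u.val - v.val) + n := by omega
      rw [this, Nat.add_mod_right, Nat.mod_eq_of_lt (by omega)]
    · rw [Nat.mod_eq_of_lt (by omega)]
  rw [cycleGraph_adj', key, key]
  have hu := u.2
  have hv := v.2
  split_ifs <;> omega

lemma J_path {n : ℕ} (hn : 4 ≤ n) (k : ℕ) : ∀ a : ℕ, a + k + 1 ≤ n →
    J (cycleGraph n) (Finset.univ.filter fun i : Fin n => a ≤ i.val ∧ i.val < a + k) = p k := by
  induction k using Nat.strong_induction_on with
  | _ k ih =>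
  intro a ha
  match k with
  | 0 =>
    have : (Finset.univ.filter fun i : Fin n => a ≤ i.val ∧ i.val < a + 0) = ∅ := by
      ext i; simp
    rw [this, J_empty, p]
  | 1 =>
    rw [J_del (cycleGraph n) (v := ⟨a, by omega⟩) (A := ∅) (B := ∅), J_empty, p, mul_one]
    · intro w; simp [Fin.ext_iff]; omega
    · simp
    · simp
  | k+2 =>
    rw [J_del (cycleGraph n) (v := ⟨a + k + 1, by omega⟩)
      (A := Finset.univ.filter fun i : Fin n => a ≤ i.val ∧ i.val < a + (k+1))
      (B := Finset.univ.filter fun i : Fin n => a ≤ i.val ∧ i.val < a + k),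
      ih (k+1) (by omega) a (by omega), ih k (by omega) a (by omega), p_add_two]
    · intro w; simp [Fin.ext_iff]; omega
    · simp only [Finset.mem_filter]; omega
    · intro w
      simp only [Finset.mem_filter, Finset.mem_univ, true_and, cyc_adj hn, and_true]
      omega

lemma J_cycle (k : ℕ) : (cycleGraph (k+4)).indepPoly = p (k+3) + X * p (k+1) := by
  rw [J_univ]
  have hn : 4 ≤ k + 4 := by omega
  rw [J_del (cycleGraph (k+4)) (v := ⟨k+3, by omega⟩)
    (A := Finset.univ.filter fun i : Fin (k+4) => 0 ≤ i.val ∧ i.val < 0 + (k+3))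
    (B := Finset.univ.filter fun i : Fin (k+4) => 1 ≤ i.val ∧ i.val < 1 + (k+1)),
    J_path hn _ _ (by omega), J_path hn _ _ (by omega)]
  · intro w; have := w.2; simp only [Finset.mem_univ, Finset.mem_filter, Fin.ext_iff]; simp only [true_and, true_iff]; omega
  · simp
  · intro w
    simp only [Finset.mem_filter, Finset.mem_univ, true_and, cyc_adj hn, and_true]
    have := w.2
    omega

variable {V : Type} [Fintype V] (G : SimpleGraph V)

lemma J_eval_zero (S : Finset V) : (J G S).eval 0 = 1 := by
  induction S using Finset.induction_on with
  | empty => simp [J_empty]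
  | insert v S hv ih => rw [J_insert G hv]; simp [ih]

lemma J_d1 (S : Finset V) : (derivative (J G S)).eval 0 = ∑ v ∈ S, (1 : ℚ) := by
  rw [J_deriv, eval_finsetSum]
  simp only [J_eval_zero]

lemma J_d2 (S : Finset V) : (derivative (derivative (J G S))).eval 0 =
    ∑ v ∈ S, ∑ w ∈ S.filter (fun w => w ≠ v ∧ ¬ G.Adj v w), (1 : ℚ) := by
  rw [J_deriv, derivative_sum, eval_finsetSum]
  simp only [J_d1]

lemma J_d3 (S : Finset V) : (derivative (derivative (derivative (J G S)))).eval 0 =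
    ∑ v ∈ S, ∑ u ∈ S.filter (fun w => w ≠ v ∧ ¬ G.Adj v w),
      ∑ w ∈ (S.filter (fun w => w ≠ v ∧ ¬ G.Adj v w)).filter (fun w => w ≠ u ∧ ¬ G.Adj u w), (1 : ℚ) := by
  rw [J_deriv, derivative_sum, derivative_sum, eval_finsetSum]
  simp only [J_d2]

/-- adjacency indicator -/
noncomputable def a (u v : V) : ℚ := if G.Adj u v then 1 else 0
/-- non adjacency indicator -/
noncomputable def b (u v : V) : ℚ := if v ≠ u ∧ ¬ G.Adj u v then 1 else 0

/-- number of ordered triangles -/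
noncomputable def T : ℚ := ∑ u, ∑ v, ∑ w, a G u v * a G u w * a G v w

lemma d3_b : (derivative (derivative (derivative (J G Finset.univ)))).eval 0 =
    ∑ u, ∑ v, ∑ w, b G u v * b G u w * b G v w := by
  rw [J_d3]
  refine Finset.sum_congr rfl fun u _ => ?_
  rw [Finset.sum_filter]
  refine Finset.sum_congr rfl fun v _ => ?_
  split_ifs with h
  · rw [Finset.filter_filter, Finset.sum_filter]
    refine Finset.sum_congr rfl fun w _ => ?_
    unfold b
    rw [if_pos h, one_mul]
    split_ifs <;> simp_all
  · symm
    apply Finset.sum_eq_zero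
    intro w _
    unfold b
    rw [if_neg h, zero_mul, zero_mul]

lemma d3_compl : (derivative (derivative (derivative (J Gᶜ Finset.univ)))).eval 0 = T G := by
  rw [d3_b]
  unfold T
  have : ∀ u v, b Gᶜ u v = a G u v := by
    intro u v
    unfold a b
    congr 1
    rw [SimpleGraph.compl_adj, eq_iff_iff]
    constructor
    · rintro ⟨h1, h2⟩
      by_contra h
      exact h2 ⟨h1.symm, h⟩
    · intro h
      exact ⟨h.ne', fun h' => h'.2 h⟩
  simp only [this]

/-- degree -/
noncomputable def d (u : V) : ℚ := ∑ v, a G u v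

lemma a_symm (u v : V) : a G u v = a G v u := by
  unfold a; simp only [G.adj_comm]

lemma a_self (u : V) : a G u u = 0 := by simp [a]

lemma a_idem (u v : V) : a G u v * a G u v = a G u v := by
  unfold a; split_ifs <;> simp

lemma b_eq (u v : V) : b G u v = 1 - a G u v - (if u = v then 1 else 0) := by
  unfold a b
  by_cases h : u = v
  · subst h; simp
  · have h' : v ≠ u := fun e => h e.symm
    by_cases h2 : G.Adj u v <;> simp [h, h', h2]

lemma triple_id (u v w : V) : b G u v * b G u w * b G v w + a G u v * a G u w * a G v w =
    1 - (a G u v + a G u w + a G v w)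
     + (a G u v * a G u w + a G v u * a G v w + a G w u * a G w v)
     - (if u = v then (1 - a G u w) else 0) - (if v = w then (1 - a G u v) else 0)
     - (if u = w then (1 - a G u v) else 0) + 2 * (if u = v then (if v = w then 1 else 0) else 0) := by
  rw [b_eq, b_eq, b_eq, a_symm G v u, a_symm G w u, a_symm G w v]
  by_cases h1 : u = v
  · subst h1
    by_cases h2 : u = w
    · subst h2; simp [a_self]; norm_num
    · have := a_idem G u w
      simp [h2, a_self]; linear_combination (-1 : ℚ) * this
  · by_cases h2 : v = w
    · subst h2
      have := a_idem G u v
      simp [h1, a_self]; linear_combination (-1 : ℚ) * this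
    · by_cases h3 : u = w
      · subst h3
        have := a_idem G u v
        simp [h1, h2, a_self, a_symm G v u]; linear_combination (-1 : ℚ) * this
      · simp [h1, h2, h3]; ring

lemma triple_sum : ∑ u, ∑ v, ∑ w, b G u v * b G u w * b G v w + T G =
    (Fintype.card V : ℚ)^3 - 3 * Fintype.card V * (∑ u, d G u) + 3 * (∑ u, d G u ^ 2)
      - 3 * ((Fintype.card V : ℚ)^2 - ∑ u, d G u) + 2 * Fintype.card V := by
  unfold T
  simp only [← Finset.sum_add_distrib]
  simp only [triple_id]
  have e1 : ∑ u, ∑ v, ∑ w, (a G u v * a G u w) = ∑ u, d G u ^ 2 := by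
    refine Finset.sum_congr rfl fun u _ => ?_
    unfold d
    rw [sq, Finset.sum_mul_sum]
  have e2 : ∑ u, ∑ v, ∑ w, (a G v u * a G v w) = ∑ u, d G u ^ 2 := by
    rw [Finset.sum_comm]
    exact e1
  have e3 : ∑ u, ∑ v, ∑ w, (a G w u * a G w v) = ∑ u, d G u ^ 2 := by
    rw [← e1, Finset.sum_comm_cycle]
  have e4 : ∀ u, ∑ v, a G u v = d G u := fun u => rfl
  have e5 : ∑ u, ∑ v, ∑ w : V, a G u v = Fintype.card V * ∑ u, d G u := by
    simp [e4, ← Finset.mul_sum]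
  have e6 : ∑ u, ∑ v : V, ∑ w, a G u w = Fintype.card V * ∑ u, d G u := by
    simp [e4, ← Finset.mul_sum]
  have e7 : ∑ u : V, ∑ v, ∑ w, a G v w = Fintype.card V * ∑ u, d G u := by
    simp [e4]
  simp only [Finset.sum_add_distrib, Finset.sum_sub_distrib, e1, e2, e3, e5, e6, e7]
  have f1 : ∑ u : V, ∑ v, ∑ w, (if u = v then (1 - a G u w) else 0) = (Fintype.card V : ℚ)^2 - ∑ u, d G u := by
    rw [Finset.sum_congr rfl fun u _ => Finset.sum_comm]
    simp [e4, sq]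
  have f2 : ∑ u : V, ∑ v, ∑ w, (if v = w then (1 - a G u v) else 0) = (Fintype.card V : ℚ)^2 - ∑ u, d G u := by
    simp [e4, sq]
  have f3 : ∑ u : V, ∑ v, ∑ w, (if u = w then (1 - a G u v) else 0) = (Fintype.card V : ℚ)^2 - ∑ u, d G u := by
    simp [e4, sq]
  have f4 : ∑ u : V, ∑ v, ∑ w, 2 * (if u = v then (if v = w then (1:ℚ) else 0) else 0) = 2 * Fintype.card V := by
    simp; ring
  rw [f1, f2, f3, f4]
  simp
  ring

lemma T_formula (k : ℕ) (h : J G Finset.univ = p (k+3) + X * p (k+1)) :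
    T G = 3 * ∑ u, (d G u - 1) * (d G u - 2) := by
  have hD := D_formula (k+1)
  rw [show k+1+2 = k+3 from rfl, ← h] at hD
  have g1 : (Fintype.card V : ℚ) = k + 4 := by
    have h1 := congrArg (eval 0) hD
    rw [J_d1] at h1
    simp [p_zero] at h1
    linarith
  have cst : derivative (((k+1 : ℕ) : ℚ[X]) + 3) = 0 := by
    have : (3 : ℚ[X]) = C 3 := rfl
    rw [this]; simp
  have g2 : ∑ u, ∑ v, b G u v = (k+4 : ℚ) * (k + 1) := by
    have h1 := congrArg (fun q => eval 0 (derivative q)) hD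
    simp only [J_d2, derivative_mul, cst] at h1
    simp [p_d1, -Finset.sum_const] at h1
    unfold b
    simp only [Finset.sum_boole]
    simp at h1 ⊢
    linarith
  have g2' : ∑ u, d G u = 2 * (k+4 : ℚ) := by
    simp only [b_eq, Finset.sum_sub_distrib] at g2
    simp only [Finset.sum_const, Finset.card_univ, nsmul_eq_mul, Finset.sum_ite_eq, Finset.mem_univ,
      if_true, mul_one, g1] at g2
    unfold d
    linarith
  have g3 := congrArg (fun q => eval 0 (derivative (derivative q))) hD
  simp only [d3_b, derivative_mul, cst, zero_mul, zero_add] at g3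
  simp [p_d2] at g3
  have g4 := triple_sum G
  rw [g3, g1, g2'] at g4
  have : ∑ u, (d G u - 1) * (d G u - 2) = ∑ u, d G u ^ 2 - 3 * ∑ u, d G u + 2 * (Fintype.card V : ℚ) := by
    rw [Finset.mul_sum, ← Finset.sum_sub_distrib]
    have : (2 * (Fintype.card V : ℚ)) = ∑ u : V, 2 := by simp; ring
    rw [this, ← Finset.sum_add_distrib]
    exact Finset.sum_congr rfl fun u _ => by ring
  rw [this, g1, g2']
  linarith

end IndepCyc

namespace IndepCyc
open scoped Classical
set_option autoImplicit false
set_option linter.unusedSectionVars false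
set_option linter.unusedVariables false

variable {V : Type} [Fintype V] (G : SimpleGraph V)

/-- value at -1/4 -/
noncomputable def f (S : Finset V) : ℝ := ev G S (-1/4)

/-- neighbours -/
noncomputable def nb (v : V) : Finset V := Finset.univ.filter fun w => G.Adj v w

lemma mem_nb (v w : V) : w ∈ nb G v ↔ G.Adj v w := by simp [nb]

lemma f_empty : f G ∅ = 1 := ev_empty G _

lemma f_insert {v : V} {S : Finset V} (hv : v ∉ S) :
    f G (insert v S) = f G S - f G (S.filter fun w => ¬ G.Adj v w) / 4 := by
  unfold f
  rw [ev_insert G hv]; ring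

section
variable {G}
variable (hf : ∀ S, 0 < f G S)

include hf

lemma f_anti {S T : Finset V} (h : S ⊆ T) : f G T ≤ f G S := by
  have : ∀ U : Finset V, f G (S ∪ U) ≤ f G S := by
    intro U
    induction U using Finset.induction_on with
    | empty => simp
    | insert v U hv ih =>
      by_cases hvS : v ∈ S ∪ U
      · rw [Finset.union_insert, Finset.insert_eq_of_mem hvS]; exact ih
      · rw [Finset.union_insert, f_insert G hvS]
        have := hf ((S ∪ U).filter fun w => ¬ G.Adj v w)
        linarith
  have h2 := this T
  rwa [Finset.union_eq_right.2 h] at h2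

lemma f_le {v : V} {S S' : Finset V} (hv : v ∉ S) (h : ∀ w ∈ S, ¬ G.Adj v w → w ∈ S') :
    f G (insert v S) ≤ f G S - f G S' / 4 := by
  rw [f_insert G hv]
  have : f G S' ≤ f G (S.filter fun w => ¬ G.Adj v w) := by
    apply f_anti hf
    intro w hw
    exact h w (Finset.mem_filter.1 hw).1 (Finset.mem_filter.1 hw).2
  linarith

lemma f_le' {v : V} {S : Finset V} (hv : v ∉ S) : f G (insert v S) ≤ 3/4 * f G S := by
  have := f_le hf hv (S' := S) (fun w hw _ => hw)
  linarith

lemma f_pow (S : Finset V) : f G S ≤ (3/4)^S.card := by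
  induction S using Finset.induction_on with
  | empty => simp [f_empty]
  | insert v S hv ih =>
    have := f_le' hf hv
    rw [Finset.card_insert_of_notMem hv, pow_succ]
    linarith

lemma f_nb (v : V) {D : Finset V} (hD : D ⊆ nb G v) : 1/4 < f G D := by
  have hv : v ∉ nb G v := by simp [mem_nb]
  have h1 := hf (insert v (nb G v))
  rw [f_insert G hv] at h1
  have h2 : (nb G v).filter (fun w => ¬ G.Adj v w) = ∅ := by
    ext w; simp [mem_nb]
  rw [h2, f_empty] at h1
  have := f_anti hf hD
  linarith

lemma nb_le_four (v : V) : (nb G v).card ≤ 4 := by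
  by_contra! h
  have h1 := f_nb hf v (D := nb G v) subset_rfl
  have h2 := f_pow hf (nb G v)
  have h3 : ((3:ℝ)/4)^(nb G v).card ≤ (3/4)^5 := pow_le_pow_of_le_one (by norm_num) (by norm_num) h
  norm_num at h3
  linarith

/-- no K4 -/
lemma no_K4 {v a b c : V} (ha : G.Adj v a) (hb : G.Adj v b) (hc : G.Adj v c)
    (hab : G.Adj a b) (hac : G.Adj a c) (hbc : G.Adj b c) : False := by
  have h1 := f_nb hf v (D := {a, b, c}) (by
    intro w; simp [mem_nb]; rintro (rfl | rfl | rfl) <;> assumption)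
  have h2 : f G {a, b, c} ≤ f G {b, c} - f G ∅ / 4 := f_le hf (by simp [hab.ne, hac.ne]) (by
    intro w; simp; rintro (rfl | rfl) <;> assumption)
  have h3 : f G {b, c} ≤ f G {c} - f G ∅ / 4 := f_le hf (by simp [hbc.ne]) (by
    intro w; simp; rintro rfl; assumption)
  have h4 := f_pow hf {c}
  rw [f_empty] at *
  norm_num at h4
  linarith

/-- degree 4: at most one edge -/
lemma deg4_share {v a b c e : V} (ha : G.Adj v a) (hb : G.Adj v b) (hc : G.Adj v c) (he : G.Adj v e)
    (hbc : b ≠ c) (h1 : e ≠ a) (h2 : e ≠ b) (h3 : e ≠ c)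
    (hab : G.Adj a b) (hac : G.Adj a c) : False := by
  have g1 := f_nb hf v (D := {e, a, b, c}) (by
    intro w; simp [mem_nb]; rintro (rfl | rfl | rfl | rfl) <;> assumption)
  have g2 : f G {e, a, b, c} ≤ 3/4 * f G {a, b, c} := f_le' hf (by simp [h1, h2, h3])
  have g3 : f G {a, b, c} ≤ f G {b, c} - f G ∅ / 4 := f_le hf (by simp [hab.ne, hac.ne]) (by
    intro w; simp; rintro (rfl | rfl) <;> assumption)
  have g4 := f_pow hf {b, c}
  rw [Finset.card_pair hbc] at g4
  rw [f_empty] at *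
  norm_num at g4
  linarith

lemma deg4_disj {v a b c e : V} (ha : G.Adj v a) (hb : G.Adj v b) (hc : G.Adj v c) (he : G.Adj v e)
    (hac : a ≠ c) (hae : a ≠ e) (hbc : b ≠ c) (hbe : b ≠ e)
    (hab : G.Adj a b) (hce : G.Adj c e) : False := by
  have g1 := f_nb hf v (D := {a, b, c, e}) (by
    intro w; simp [mem_nb]; rintro (rfl | rfl | rfl | rfl) <;> assumption)
  have g2 : f G {a, b, c, e} ≤ f G {b, c, e} - f G {c, e} / 4 := f_le hf (by simp [hab.ne, hac, hae]) (by
    intro w; simp; rintro (rfl | rfl | rfl) h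
    · contradiction
    · simp
    · simp)
  have g3 : f G {b, c, e} ≤ 3/4 * f G {c, e} := f_le' hf (by simp [hbc, hbe])
  have g4 : f G {c, e} ≤ f G {e} - f G ∅ / 4 := f_le hf (by simp [hce.ne]) (by
    intro w; simp; rintro rfl; assumption)
  have g5 := f_pow hf {e}
  rw [f_empty] at *
  norm_num at g5
  linarith

end

/-- ordered pairs of adjacent neighbours -/
noncomputable def P (v : V) : Finset (V × V) :=
  Finset.univ.filter fun q => G.Adj v q.1 ∧ G.Adj v q.2 ∧ G.Adj q.1 q.2

lemma mem_P (v x y : V) : (x, y) ∈ P G v ↔ G.Adj v x ∧ G.Adj v y ∧ G.Adj x y := by simp [P]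

lemma card_four_le {α : Type} (x y z t : α) : ({x, y, z, t} : Finset α).card ≤ 4 :=
  Finset.card_le_four

lemma P_four (v x y z : V) (hN : ∀ w, G.Adj v w → w = x ∨ w = y ∨ w = z) (hyz : ¬ G.Adj y z) :
    (P G v).card ≤ 4 := by
  refine le_trans (Finset.card_le_card (t := {(x,y),(y,x),(x,z),(z,x)}) ?_) Finset.card_le_four
  rintro ⟨s, t⟩ hq
  rw [mem_P] at hq
  obtain ⟨h1, h2, h3⟩ := hq
  have hzy : ¬ G.Adj z y := fun h => hyz h.symm
  rcases hN s h1 with rfl | rfl | rfl <;> rcases hN t h2 with rfl | rfl | rfl <;>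
    first
      | exact absurd h3 (G.loopless.irrefl _)
      | contradiction
      | simp

lemma P_two (v x y z : V) (hN : ∀ w, G.Adj v w → w = x ∨ w = y ∨ w = z)
    (hxz : ¬ G.Adj x z) (hyz : ¬ G.Adj y z) :
    (P G v).card ≤ 2 := by
  refine le_trans (Finset.card_le_card (t := {(x,y),(y,x)}) ?_) Finset.card_le_two
  rintro ⟨s, t⟩ hq
  rw [mem_P] at hq
  obtain ⟨h1, h2, h3⟩ := hq
  have hzy : ¬ G.Adj z y := fun h => hyz h.symm
  have hzx : ¬ G.Adj z x := fun h => hxz h.symm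
  rcases hN s h1 with rfl | rfl | rfl <;> rcases hN t h2 with rfl | rfl | rfl <;>
    first
      | exact absurd h3 (G.loopless.irrefl _)
      | contradiction
      | simp

section
variable {G}
variable (hf : ∀ S, 0 < f G S)

include hf

lemma P_deg4 (v : V) (h4 : (nb G v).card = 4) : (P G v).card ≤ 2 := by
  by_cases hne : P G v = ∅
  · simp [hne]
  obtain ⟨⟨x, y⟩, hq⟩ := Finset.nonempty_iff_ne_empty.2 hne
  rw [mem_P] at hq
  obtain ⟨hx, hy, hxy⟩ := hq
  -- a fourth neighbour
  have ex : ∀ r s t : V, ∃ e, G.Adj v e ∧ e ≠ r ∧ e ≠ s ∧ e ≠ t := by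
    intro r s t
    have : ({r, s, t} : Finset V).card < (nb G v).card := by
      have := Finset.card_le_three (a := r) (b := s) (c := t)
      omega
    obtain ⟨e, he, hne⟩ := Finset.exists_mem_notMem_of_card_lt_card this
    simp at hne
    exact ⟨e, (mem_nb G v e).1 he, hne.1, hne.2.1, hne.2.2⟩
  -- sharing a vertex
  have sh : ∀ r s t, G.Adj v r → G.Adj v s → G.Adj v t → G.Adj r s → G.Adj r t → s = t := by
    intro r s t hr hs ht hrs hrt
    by_contra hst
    obtain ⟨e, he, h1, h2, h3⟩ := ex r s t
    exact deg4_share hf hr hs ht he hst h1 h2 h3 hrs hrt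
  refine le_trans (Finset.card_le_card (t := {(x,y),(y,x)}) ?_) Finset.card_le_two
  rintro ⟨s, t⟩ hq
  rw [mem_P] at hq
  obtain ⟨hs, ht, hst⟩ := hq
  simp only [Finset.mem_insert, Finset.mem_singleton, Prod.mk.injEq]
  by_cases h1 : x = s
  · subst h1
    exact Or.inl ⟨rfl, sh _ _ _ hx ht hy hst hxy⟩
  by_cases h2 : x = t
  · subst h2
    exact Or.inr ⟨sh _ _ _ hx hs hy hst.symm hxy, rfl⟩
  by_cases h3 : y = s
  · subst h3
    exact Or.inr ⟨rfl, sh _ _ _ hy ht hx hst hxy.symm⟩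
  by_cases h4 : y = t
  · subst h4
    exact Or.inl ⟨sh _ _ _ hy hs hx hst.symm hxy.symm, rfl⟩
  exact (deg4_disj hf hx hy hs ht h1 h2 h3 h4 hxy hst).elim

lemma P_deg3 (v : V) (h3 : 3 ≤ (nb G v).card) : (P G v).card ≤ 4 := by
  have := nb_le_four hf v
  rcases (show (nb G v).card = 3 ∨ (nb G v).card = 4 by omega) with h | h
  · obtain ⟨x, y, z, -, -, -, hxyz⟩ := Finset.card_eq_three.1 h
    have hN : ∀ w, G.Adj v w ↔ w = x ∨ w = y ∨ w = z := by
      intro w; rw [← mem_nb, hxyz]; simp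
    by_cases h1 : G.Adj x y
    · by_cases h2 : G.Adj x z
      · apply P_four G v x y z (fun w => (hN w).1)
        intro h3
        exact no_K4 hf ((hN x).2 (by simp)) ((hN y).2 (by simp)) ((hN z).2 (by simp)) h1 h2 h3
      · exact P_four G v y x z (fun w hw => by have := (hN w).1 hw; tauto) h2
    · exact P_four G v z x y (fun w hw => by have := (hN w).1 hw; tauto) h1
  · exact (P_deg4 hf v h).trans (by norm_num)

end

/-- weights -/
noncomputable def wt (v : V) : ℚ := if 3 ≤ (nb G v).card then 2 / (P G v).card else 0

lemma wt_nonneg (v : V) : 0 ≤ wt G v := by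
  unfold wt; split_ifs <;> positivity

lemma wt_ge (v : V) (h : 3 ≤ (nb G v).card) (m : ℕ) (hP : (P G v).card ≤ m) (hne : (P G v).Nonempty) :
    2 / (m : ℚ) ≤ wt G v := by
  unfold wt
  rw [if_pos h]
  have : 0 < (P G v).card := hne.card_pos
  have h1 : (0 : ℚ) < (P G v).card := by exact_mod_cast this
  have h2 : ((P G v).card : ℚ) ≤ m := by exact_mod_cast hP
  gcongr

section
variable {G}
variable (hf : ∀ S, 0 < f G S)

include hf

lemma tri_wt1 {u v w : V} (huv : G.Adj u v) (huw : G.Adj u w) (hvw : G.Adj v w)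
    (hd : 3 ≤ (nb G u).card) : 1 ≤ wt G u + wt G v + wt G w := by
  have n1 := wt_nonneg G u
  have n2 := wt_nonneg G v
  have n3 := wt_nonneg G w
  have hPu : (P G u).Nonempty := ⟨(v, w), (mem_P _ _ _ _).2 ⟨huv, huw, hvw⟩⟩
  have hPv : (P G v).Nonempty := ⟨(u, w), (mem_P _ _ _ _).2 ⟨huv.symm, hvw, huw⟩⟩
  have hPw : (P G w).Nonempty := ⟨(u, v), (mem_P _ _ _ _).2 ⟨huw.symm, hvw.symm, huv⟩⟩
  have := nb_le_four hf u
  have card3 : ∀ s x y z : V, x ≠ y → x ≠ z → y ≠ z → G.Adj s x → G.Adj s y → G.Adj s z →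
      3 ≤ (nb G s).card := by
    intro s x y z h1 h2 h3 h4 h5 h6
    rw [← Finset.card_eq_three.2 ⟨x, y, z, h1, h2, h3, rfl⟩]
    apply Finset.card_le_card
    intro t; simp [mem_nb]; rintro (rfl | rfl | rfl) <;> assumption
  rcases (show (nb G u).card = 4 ∨ (nb G u).card = 3 by omega) with h | h
  · have := wt_ge G u hd 2 (P_deg4 hf u h) hPu
    norm_num at this
    linarith
  · obtain ⟨y, hy, hyn⟩ : ∃ y ∈ nb G u, y ∉ ({v, w} : Finset V) := by
      apply Finset.exists_mem_notMem_of_card_lt_card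
      rw [h]
      exact lt_of_le_of_lt Finset.card_le_two (by norm_num)
    rw [mem_nb] at hy
    simp at hyn
    obtain ⟨hyv, hyw⟩ := hyn
    have hN : ∀ t, G.Adj u t → t = v ∨ t = w ∨ t = y := by
      have : ({v, w, y} : Finset V) = nb G u := by
        apply Finset.eq_of_subset_of_card_le
        · intro t; simp [mem_nb]; rintro (rfl | rfl | rfl) <;> assumption
        · rw [h, Finset.card_eq_three.2 ⟨v, w, y, hvw.ne, Ne.symm hyv, Ne.symm hyw, rfl⟩]
      intro t ht
      rw [← mem_nb, ← this] at ht
      simpa using ht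
    have half := wt_ge G u hd 4 (P_deg3 hf u hd) hPu
    norm_num at half
    by_cases h1 : G.Adj v y
    · have hd' := card3 v u w y huw.ne hy.ne (Ne.symm hyw) huv.symm hvw h1
      have := wt_ge G v hd' 4 (P_deg3 hf v hd') hPv
      norm_num at this
      linarith
    · by_cases h2 : G.Adj w y
      · have hd' := card3 w u v y huv.ne hy.ne (Ne.symm hyv) huw.symm hvw.symm h2
        have := wt_ge G w hd' 4 (P_deg3 hf w hd') hPw
        norm_num at this
        linarith
      · have := wt_ge G u hd 2 (P_two G u v w y hN h1 h2) hPu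
        norm_num at this
        linarith

end

/-- isolated triangles, ordered -/
noncomputable def isoTri : Finset (V × V × V) := Finset.univ.filter fun q =>
  G.Adj q.1 q.2.1 ∧ G.Adj q.1 q.2.2 ∧ G.Adj q.2.1 q.2.2 ∧
   (nb G q.1).card ≤ 2 ∧ (nb G q.2.1).card ≤ 2 ∧ (nb G q.2.2).card ≤ 2

lemma a_P (u : V) : ∑ v, ∑ w, a G u v * a G u w * a G v w = (P G u).card := by
  unfold P
  rw [Finset.card_filter, Fintype.sum_prod_type]
  push_cast
  refine Finset.sum_congr rfl fun v _ => Finset.sum_congr rfl fun w _ => ?_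
  unfold a
  split_ifs <;> simp_all

lemma wt_sum (u : V) : ∑ v, ∑ w, a G u v * a G u w * a G v w * wt G u ≤
    if 3 ≤ (nb G u).card then 2 else 0 := by
  simp only [← Finset.sum_mul, a_P]
  unfold wt
  split_ifs
  · by_cases h : ((P G u).card : ℚ) = 0
    · simp [h]
    · rw [mul_div_cancel₀ _ h]
  · simp

lemma T_le (hf : ∀ S, 0 < f G S) :
    T G ≤ 6 * ((Finset.univ.filter fun v => 3 ≤ (nb G v).card).card : ℚ) + (isoTri G).card := by
  have pt : ∀ u v w, a G u v * a G u w * a G v w ≤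
      a G u v * a G u w * a G v w * wt G u + a G v u * a G v w * a G u w * wt G v
       + a G w u * a G w v * a G u v * wt G w + (if (u, v, w) ∈ isoTri G then 1 else 0) := by
    intro u v w
    rw [a_symm G v u, a_symm G w u, a_symm G w v]
    by_cases h : G.Adj u v ∧ G.Adj u w ∧ G.Adj v w
    · obtain ⟨h1, h2, h3⟩ := h
      simp only [a, h1, h2, h3, if_true, one_mul]
      by_cases k1 : 3 ≤ (nb G u).card
      · have := tri_wt1 hf h1 h2 h3 k1
        split_ifs <;> linarith
      by_cases k2 : 3 ≤ (nb G v).card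
      · have := tri_wt1 hf h1.symm h3 h2 k2
        split_ifs <;> linarith
      by_cases k3 : 3 ≤ (nb G w).card
      · have := tri_wt1 hf h2.symm h3.symm h1 k3
        split_ifs <;> linarith
      rw [if_pos]
      · have n1 := wt_nonneg G u
        have n2 := wt_nonneg G v
        have n3 := wt_nonneg G w
        linarith
      · simp [isoTri, h1, h2, h3]; omega
    · have : a G u v * a G u w * a G v w = 0 := by
        unfold a
        split_ifs <;> simp_all
      have e2 : a G u v * a G v w * a G u w = 0 := by rw [← this]; ring
      have e3 : a G u w * a G v w * a G u v = 0 := by rw [← this]; ring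
      rw [this, e2, e3]
      split_ifs <;> simp
  have s1 : T G ≤ ∑ u, ∑ v, ∑ w, (a G u v * a G u w * a G v w * wt G u + a G v u * a G v w * a G u w * wt G v
       + a G w u * a G w v * a G u v * wt G w + (if (u, v, w) ∈ isoTri G then 1 else 0)) := by
    unfold T
    exact Finset.sum_le_sum fun u _ => Finset.sum_le_sum fun v _ => Finset.sum_le_sum fun w _ => pt u v w
  simp only [Finset.sum_add_distrib] at s1
  have t1 : ∑ u, ∑ v, ∑ w, a G u v * a G u w * a G v w * wt G u ≤
      2 * ((Finset.univ.filter fun v => 3 ≤ (nb G v).card).card : ℚ) := by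
    refine (Finset.sum_le_sum fun u _ => wt_sum G u).trans ?_
    rw [← Finset.sum_filter]
    simp [mul_comm]
  have t2 : ∑ u, ∑ v, ∑ w, a G v u * a G v w * a G u w * wt G v =
      ∑ u, ∑ v, ∑ w, a G u v * a G u w * a G v w * wt G u := by
    rw [Finset.sum_comm]
  have t3 : ∑ u, ∑ v, ∑ w, a G w u * a G w v * a G u v * wt G w =
      ∑ u, ∑ v, ∑ w, a G u v * a G u w * a G v w * wt G u := by
    rw [Finset.sum_comm_cycle]
  have t4 : ∑ u : V, ∑ v : V, ∑ w : V, (if (u, v, w) ∈ isoTri G then (1:ℚ) else 0) = (isoTri G).card := by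
    have : ((isoTri G).card : ℚ) = ∑ q : V × V × V, if q ∈ isoTri G then 1 else 0 := by
      simp
    rw [this, Fintype.sum_prod_type]
    refine Finset.sum_congr rfl fun u _ => ?_
    rw [Fintype.sum_prod_type]
  rw [t2, t3, t4] at s1
  linarith

end IndepCyc

namespace IndepCyc
open scoped Classical
set_option autoImplicit false
set_option linter.unusedSectionVars false
set_option linter.unusedVariables false

variable {V : Type} [Fintype V] (G : SimpleGraph V)

lemma T_eq_count : T G = 6 * ((Finset.univ.filter fun s : Finset V => Gᶜ.IsIndepFinset s ∧ s.card = 3).card : ℚ) := by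
  rw [← d3_compl, ← coeff_zero_eq_eval_zero, coeff_derivative, coeff_derivative, coeff_derivative]
  have : (J Gᶜ Finset.univ).coeff 3 =
      ((Finset.univ.filter fun s : Finset V => Gᶜ.IsIndepFinset s ∧ s.card = 3).card : ℚ) := by
    unfold J
    rw [finsetSum_coeff, Finset.powerset_univ, Finset.card_filter]
    push_cast
    refine Finset.sum_congr rfl fun s _ => ?_
    by_cases h : Gᶜ.IsIndepFinset s
    · simp [h, coeff_X_pow, eq_comm]
    · simp [h]
  norm_num [this]
  ring

lemma clique_iff (s : Finset V) : Gᶜ.IsIndepFinset s ↔ ∀ x ∈ s, ∀ y ∈ s, x ≠ y → G.Adj x y := by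
  unfold SimpleGraph.IsIndepFinset
  simp only [SimpleGraph.compl_adj, not_and, not_not]

lemma count_eq : subgraphCount G (cycleGraph 3) =
    (Finset.univ.filter fun s : Finset V => Gᶜ.IsIndepFinset s ∧ s.card = 3).card := by
  unfold subgraphCount
  rw [← Fintype.card_subtype, ← Nat.card_eq_fintype_card]
  symm
  have iso : ∀ s : Finset V, Gᶜ.IsIndepFinset s ∧ s.card = 3 →
      Nonempty (((⊤ : G.Subgraph).induce (s : Set V)).coe ≃g cycleGraph 3) := by
    rintro s ⟨h1, h2⟩
    rw [clique_iff] at h1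
    rw [cycleGraph_three_eq_top]
    have e : (s : Set V) ≃ Fin 3 := (Finset.equivFinOfCardEq h2)
    refine ⟨⟨e, ?_⟩⟩
    rintro ⟨x, hx⟩ ⟨y, hy⟩
    have hx' : x ∈ s := hx
    have hy' : y ∈ s := hy
    have hinj : e ⟨x, hx⟩ ≠ e ⟨y, hy⟩ ↔ x ≠ y := by
      rw [e.injective.ne_iff]
      exact not_congr ⟨fun h => congrArg Subtype.val h, fun h => Subtype.ext h⟩
    rw [SimpleGraph.top_adj]
    refine hinj.trans ?_
    simp only [SimpleGraph.Subgraph.coe_adj, SimpleGraph.Subgraph.induce_adj,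
      SimpleGraph.Subgraph.top_adj]
    constructor
    · intro h; exact ⟨hx', hy', h1 x hx' y hy' h⟩
    · rintro ⟨_, _, h⟩; exact h.ne
  refine Nat.card_eq_of_bijective (fun s => ⟨(⊤ : G.Subgraph).induce (s.1 : Set V), iso s.1 s.2⟩) ⟨?_, ?_⟩
  · rintro ⟨s, hs⟩ ⟨t, ht⟩ hst
    have := congrArg (fun q => q.1.verts) hst
    simp at this
    exact Subtype.ext this
  · rintro ⟨H, ⟨e⟩⟩
    rw [cycleGraph_three_eq_top] at e
    have hadj : ∀ x y (hx : x ∈ H.verts) (hy : y ∈ H.verts), x ≠ y → H.Adj x y := by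
      intro x y hx hy hxy
      have := (e.map_adj_iff (v := ⟨x, hx⟩) (w := ⟨y, hy⟩)).1 (by
        rw [SimpleGraph.top_adj]
        intro h
        have := e.injective h
        exact hxy (congrArg Subtype.val this))
      exact this
    refine ⟨⟨H.verts.toFinset, ?_, ?_⟩, ?_⟩
    · rw [clique_iff]
      intro x hx y hy hxy
      exact (hadj x y (by simpa using hx) (by simpa using hy) hxy).adj_sub
    · rw [Set.toFinset_card]
      have := Fintype.card_congr e.toEquiv
      simpa using this
    · apply Subtype.ext
      apply SimpleGraph.Subgraph.ext
      · simp
      · funext x y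
        simp only [SimpleGraph.Subgraph.induce_adj, SimpleGraph.Subgraph.top_adj, eq_iff_iff, Set.coe_toFinset]
        constructor
        · rintro ⟨hx, hy, h⟩; exact hadj x y hx hy h.ne
        · intro h; exact ⟨h.fst_mem, h.snd_mem, h.adj_sub⟩

lemma nb_degree (v : V) : (nb G v).card = G.degree v := by
  rw [← SimpleGraph.card_neighborFinset_eq_degree]
  congr 1
  ext w; simp [mem_nb]

lemma d_nb (v : V) : d G v = (nb G v).card := by
  unfold d nb a
  simp

lemma J_iso_tri (S : Finset V) {x y z : V} (hx : x ∉ S) (hy : y ∉ S) (hz : z ∉ S)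
    (hxy : G.Adj x y) (hxz : G.Adj x z) (hyz : G.Adj y z)
    (nx : ∀ w ∈ S, ¬ G.Adj x w) (ny : ∀ w ∈ S, ¬ G.Adj y w) (nz : ∀ w ∈ S, ¬ G.Adj z w) :
    J G (insert x (insert y (insert z S))) = (1 + 3 * X) * J G S := by
  rw [J_del G (v := x) (A := insert y (insert z S)) (B := S),
    J_del G (v := y) (A := insert z S) (B := S),
    J_del G (v := z) (A := S) (B := S)]
  · ring
  · intro w; simp
  · exact hz
  · intro w; constructor
    · intro h; exact ⟨h, nz w h⟩
    · exact fun h => h.1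
  · intro w; simp
  · simp [hyz.ne, hy]
  · intro w; simp only [Finset.mem_insert]; constructor
    · intro h; exact ⟨Or.inr h, ny w h⟩
    · rintro ⟨rfl | h, h2⟩
      · exact absurd hyz h2
      · exact h
  · intro w; simp
  · simp [hxy.ne, hxz.ne, hx]
  · intro w; simp only [Finset.mem_insert]; constructor
    · intro h; exact ⟨Or.inr (Or.inr h), nx w h⟩
    · rintro ⟨rfl | rfl | h, h2⟩
      · exact absurd hxy h2
      · exact absurd hxz h2
      · exact h

lemma nb_two {u v w : V} (huv : G.Adj u v) (huw : G.Adj u w) (hvw : v ≠ w)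
    (h : (nb G u).card ≤ 2) : ∀ t, G.Adj u t ↔ t = v ∨ t = w := by
  have : ({v, w} : Finset V) = nb G u := by
    apply Finset.eq_of_subset_of_card_le
    · intro t; simp [mem_nb]; rintro (rfl | rfl) <;> assumption
    · rw [Finset.card_pair hvw]; exact h
  intro t
  rw [← mem_nb, ← this]; simp

lemma isoTri_card (k : ℕ) (h : J G Finset.univ = p (k+2) + X * p k) : (isoTri G).card ≤ 6 := by
  by_cases hne : isoTri G = ∅
  · simp [hne]
  obtain ⟨⟨x, y, z⟩, hq⟩ := Finset.nonempty_iff_ne_empty.2 hne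
  simp [isoTri] at hq
  obtain ⟨hxy, hxz, hyz, cx, cy, cz⟩ := hq
  have Nx := nb_two G hxy hxz hyz.ne cx
  have Ny := nb_two G hxy.symm hyz hxz.ne cy
  have Nz := nb_two G hxz.symm hyz.symm hxy.ne cz
  refine le_trans (Finset.card_le_card
    (t := {(x,y,z),(x,z,y),(y,x,z),(y,z,x),(z,x,y),(z,y,x)}) ?_) Finset.card_le_six
  rintro ⟨u, v, w⟩ hq
  simp [isoTri] at hq
  obtain ⟨huv, huw, hvw, cu, cv, cw⟩ := hq
  by_cases hu : u = x ∨ u = y ∨ u = z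
  · have e1 := huv.ne
    have e2 := huw.ne
    have e3 := hvw.ne
    rcases hu with rfl | rfl | rfl
    · rcases (Nx v).1 huv with rfl | rfl <;> rcases (Nx w).1 huw with rfl | rfl <;> simp_all
    · rcases (Ny v).1 huv with rfl | rfl <;> rcases (Ny w).1 huw with rfl | rfl <;> simp_all
    · rcases (Nz v).1 huv with rfl | rfl <;> rcases (Nz w).1 huw with rfl | rfl <;> simp_all
  · exfalso
    have Nu := nb_two G huv huw hvw.ne cu
    have Nv := nb_two G huv.symm hvw huw.ne cv
    have Nw := nb_two G huw.symm hvw.symm huv.ne cw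
    -- the set {x,y,z} is closed under adjacency
    have cl : ∀ s t, G.Adj s t → (t = x ∨ t = y ∨ t = z) → (s = x ∨ s = y ∨ s = z) := by
      intro s t hst ht
      rcases ht with rfl | rfl | rfl
      · have := (Nx s).1 hst.symm; tauto
      · have := (Ny s).1 hst.symm; tauto
      · have := (Nz s).1 hst.symm; tauto
    have hv : ¬ (v = x ∨ v = y ∨ v = z) := fun h => hu (cl u v huv h)
    have hw : ¬ (w = x ∨ w = y ∨ w = z) := fun h => hu (cl u w huw h)
    push Not at hu hv hw
    set R : Finset V := Finset.univ.filter fun t => t ≠ x ∧ t ≠ y ∧ t ≠ z ∧ t ≠ u ∧ t ≠ v ∧ t ≠ w with hR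
    have m : ∀ t, t ∈ R ↔ t ≠ x ∧ t ≠ y ∧ t ≠ z ∧ t ≠ u ∧ t ≠ v ∧ t ≠ w := by
      intro t; simp [hR]
    have E : (Finset.univ : Finset V) =
        insert x (insert y (insert z (insert u (insert v (insert w R))))) := by
      ext t
      simp only [Finset.mem_univ, Finset.mem_insert, m, true_iff]
      tauto
    have r1 : J G (insert u (insert v (insert w R))) = (1 + 3 * X) * J G R := by
      apply J_iso_tri G R _ _ _ huv huw hvw
      · intro t ht; rw [Nu]; rw [m] at ht; tauto
      · intro t ht; rw [Nv]; rw [m] at ht; tauto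
      · intro t ht; rw [Nw]; rw [m] at ht; tauto
      · rw [m]; tauto
      · rw [m]; tauto
      · rw [m]; tauto
    have mm : ∀ t ∈ insert u (insert v (insert w R)), t ≠ x ∧ t ≠ y ∧ t ≠ z := by
      intro t ht
      simp only [Finset.mem_insert, m] at ht
      rcases ht with rfl | rfl | rfl | ht
      · exact hu
      · exact hv
      · exact hw
      · tauto
    have r2 : J G Finset.univ = (1 + 3 * X) * J G (insert u (insert v (insert w R))) := by
      rw [E]
      apply J_iso_tri G _ _ _ _ hxy hxz hyz
      · intro t ht; rw [Nx]; have := mm t ht; tauto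
      · intro t ht; rw [Ny]; have := mm t ht; tauto
      · intro t ht; rw [Nz]; have := mm t ht; tauto
      · exact fun h => (mm _ h).1 rfl
      · exact fun h => (mm _ h).2.1 rfl
      · exact fun h => (mm _ h).2.2 rfl
    apply C_third k (J G R)
    rw [← h, r2, r1]; ring

lemma no_isolated (k : ℕ) (h : J G Finset.univ = p (k+2) + X * p k) (v : V) : 1 ≤ (nb G v).card := by
  by_contra! hc
  have h0 : nb G v = ∅ := Finset.card_eq_zero.1 (by omega)
  apply C_neg_one k
  rw [← h, J_del G (v := v) (A := Finset.univ.erase v) (B := Finset.univ.erase v)]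
  · simp
  · intro w; simp; tauto
  · simp
  · intro w
    have : ¬ G.Adj v w := by rw [← mem_nb, h0]; simp
    simp [this]

lemma all_pos (k : ℕ) (h : J G Finset.univ = p (k+2) + X * p k) : ∀ S, 0 < f G S := by
  intro S
  apply ev_pos G Finset.univ (-1/4) _ S (Finset.subset_univ _) _ ⟨le_rfl, by norm_num⟩
  intro x hx
  unfold ev
  rw [h]
  exact C_pos x hx k

lemma main (k : ℕ) (h : J G Finset.univ = p (k+3) + X * p (k+1)) :
    (∀ v, (nb G v).card ≤ 3) ∧
      subgraphCount G (cycleGraph 3) = (Finset.univ.filter fun v => (nb G v).card = 3).card := by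
  have hf := all_pos G (k+1) h
  have h1 := T_formula G k h
  have h2 := T_le G hf
  have h3 : ((isoTri G).card : ℚ) ≤ 6 := by exact_mod_cast isoTri_card G (k+1) h
  have hpt : ∀ v, (d G v - 1) * (d G v - 2) =
      2 * (if (nb G v).card = 3 then 1 else 0) + 6 * (if (nb G v).card = 4 then 1 else 0) := by
    intro v
    have a1 := no_isolated G (k+1) h v
    have a2 := nb_le_four hf v
    rw [d_nb]
    generalize (nb G v).card = m at *
    interval_cases m <;> norm_num
  have hsum : T G = 6 * ((Finset.univ.filter fun v => (nb G v).card = 3).card : ℚ) +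
      18 * ((Finset.univ.filter fun v => (nb G v).card = 4).card : ℚ) := by
    rw [h1]
    simp only [hpt, Finset.sum_add_distrib, ← Finset.mul_sum]
    simp only [Finset.sum_boole]
    ring
  have hcard : ((Finset.univ.filter fun v => 3 ≤ (nb G v).card).card : ℚ) =
      ((Finset.univ.filter fun v => (nb G v).card = 3).card : ℚ) +
      ((Finset.univ.filter fun v => (nb G v).card = 4).card : ℚ) := by
    simp only [← Finset.sum_boole]
    rw [← Finset.sum_add_distrib]
    refine Finset.sum_congr rfl fun v _ => ?_
    have a2 := nb_le_four hf v
    generalize (nb G v).card = m at *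
    interval_cases m <;> norm_num
  have h4 : (Finset.univ.filter fun v => (nb G v).card = 4).card = 0 := by
    have : ((Finset.univ.filter fun v => (nb G v).card = 4).card : ℚ) < 1 := by
      rw [hcard, hsum] at h2
      linarith
    have : (Finset.univ.filter fun v => (nb G v).card = 4).card < 1 := by exact_mod_cast this
    omega
  constructor
  · intro v
    have a2 := nb_le_four hf v
    by_contra! hc
    have : v ∈ Finset.univ.filter fun v => (nb G v).card = 4 := by simp; omega
    rw [Finset.card_eq_zero.1 h4] at this
    simp at this
  · rw [T_eq_count, ← count_eq, h4] at hsum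
    have : (subgraphCount G (cycleGraph 3) : ℚ) = ((Finset.univ.filter fun v => (nb G v).card = 3).card : ℚ) := by
      simp at hsum ⊢
      linarith
    exact_mod_cast this

end IndepCyc


open scoped Classical in
/-- For `n ≥ 4`, if `I(G,x) = I(C_n,x)` then the maximum degree of `G` is at most `3` and
the number of triangles of `G` equals the number of vertices of degree `3`. -/
theorem maxDegree_le_three {n : ℕ} (hn : 4 ≤ n) {V : Type} [Fintype V] (G : SimpleGraph V)
    (h : G.indepPoly = (cycleGraph n).indepPoly) :
    G.maxDegree ≤ 3 ∧
    subgraphCount G (cycleGraph 3) =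
      (Finset.univ.filter fun v : V => G.degree v = 3).card := by
  obtain ⟨k, rfl⟩ : ∃ k, n = k + 4 := ⟨n - 4, by omega⟩
  rw [IndepCyc.J_univ, IndepCyc.J_cycle] at h
  obtain ⟨h1, h2⟩ := IndepCyc.main G k h
  simp only [IndepCyc.nb_degree] at h1 h2
  exact ⟨SimpleGraph.maxDegree_le_of_forall_degree_le _ _ h1, h2⟩
end
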